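/- arXiv:1202.2230 — 2 statements merged into one kernel-verified Lean document; each statement's English description precedes it below -/
import Mathlib

section
/- Littlewood's identity (finite-variable form): for every positive integer N, in the polynomial ring ℤ[x_0,…,x_{N−1}] one has ∏_{i}(1−x_i) · ∏_{i<j}(1−x_i x_j) = Σ_λ (−1)^{(|λ|+r(λ))/2} s_λ(x_0,…,x_{N−1}), where the (finite) sum runs over all self-conjugate Young diagrams λ contained in the N×N square (equivalently, all self-conjugate λ with at most N rows; for all other self-conjugate λ the Schur polynomial in N variables vanishes). -/
open MvPolynomial

/-- The rank of a Young diagram: the number of diagonal cells. -/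
def YoungDiagram.diagRank (lam : YoungDiagram) : ℕ :=
  (lam.cells.filter fun c => c.1 = c.2).card

/-- The Schur polynomial of shape `lam` in the variables `x_0, …, x_{N-1}`:
the sum, over all semistandard Young tableaux of shape `lam` with entries in
`{0, …, N-1}`, of the monomial recording the content of the tableau. -/
noncomputable def schurPoly (N : ℕ) (lam : YoungDiagram) : MvPolynomial (Fin N) ℤ :=
  ∑ᶠ T ∈ {T : SemistandardYoungTableau lam | ∀ i j : ℕ, (i, j) ∈ lam → T i j < N},
    ∏ k : Fin N, (X k : MvPolynomial (Fin N) ℤ) ^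
      ((lam.cells.filter fun c => T c.1 c.2 = (k : ℕ)).card)


lemma lw_geom {R : Type*} [CommRing R] (y t : R) (a b : ℕ) (h : a ≤ b) :
    y ^ b - t ^ (b - a) * y ^ a = (y - t) * ∑ m ∈ Finset.Ico a b, t ^ (b - 1 - m) * y ^ m := by
  induction b, h using Nat.le_induction with
  | base => simp
  | succ b hb ih =>
    rw [Finset.sum_Ico_succ_top hb, mul_add]
    have : ∑ m ∈ Finset.Ico a b, t ^ (b + 1 - 1 - m) * y ^ m
        = t * ∑ m ∈ Finset.Ico a b, t ^ (b - 1 - m) * y ^ m := by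
      rw [Finset.mul_sum]
      refine Finset.sum_congr rfl fun m hm => ?_
      rw [Finset.mem_Ico] at hm
      rw [show b + 1 - 1 - m = (b - 1 - m) + 1 by omega, pow_succ]; ring
    rw [this, mul_left_comm, ← ih, show b + 1 - a = (b - a) + 1 by omega]
    simp; ring

lemma lw_det_branch {R : Type*} [CommRing R] (N : ℕ) (y : Fin (N + 1) → R)
    (k : Fin (N + 1) → ℕ) (hk : Monotone k) :
    (Matrix.of fun i j => y i ^ k j).det =
      y 0 ^ k 0 * ((∏ i : Fin N, (y i.succ - y 0)) *
        ∑ m ∈ Fintype.piFinset (fun j : Fin N => Finset.Ico (k j.castSucc) (k j.succ)),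
          (∏ j, y 0 ^ (k j.succ - 1 - m j)) *
            (Matrix.of fun i j : Fin N => y i.succ ^ m j).det) := by
  let B : Matrix (Fin (N + 1)) (Fin (N + 1)) R := fun i => Fin.cons (y i ^ k 0)
    (fun j : Fin N => y i ^ k j.succ - y 0 ^ (k j.succ - k j.castSucc) * y i ^ k j.castSucc)
  have h1 : (Matrix.of fun i j => y i ^ k j).det = B.det := by
    refine Matrix.det_eq_of_forall_col_eq_smul_add_pred
      (fun j : Fin N => y 0 ^ (k j.succ - k j.castSucc)) ?_ ?_
    · intro i; simp [B]
    · intro i j; simp [B]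
  have hle : ∀ j : Fin N, k j.castSucc ≤ k j.succ := fun j => hk (Fin.castSucc_le_succ j)
  have hB0 : ∀ j : Fin N, B 0 j.succ = 0 := by
    intro j
    simp only [B, Fin.cons_succ]
    rw [← pow_add, Nat.sub_add_cancel (hle j), sub_self]
  rw [h1, Matrix.det_succ_row_zero, Fin.sum_univ_succ]
  simp only [hB0, mul_zero, zero_mul, Finset.sum_const_zero, add_zero]
  have h2 : B.submatrix Fin.succ (Fin.succAbove 0) = Matrix.of fun i j : Fin N =>
      (y i.succ - y 0) * (Matrix.of fun i j : Fin N => ∑ m ∈ Finset.Ico (k j.castSucc) (k j.succ),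
        y 0 ^ (k j.succ - 1 - m) * y i.succ ^ m) i j := by
    ext i j
    rw [Matrix.submatrix_apply, Fin.succAbove_zero]
    simp only [B, Matrix.of_apply, Fin.cons_succ]
    rw [lw_geom _ _ _ _ (hle j)]
  rw [h2, Matrix.det_mul_column]
  have h3 : (Matrix.of fun i j : Fin N => ∑ m ∈ Finset.Ico (k j.castSucc) (k j.succ),
        y 0 ^ (k j.succ - 1 - m) * y i.succ ^ m).det =
      ∑ m ∈ Fintype.piFinset (fun j : Fin N => Finset.Ico (k j.castSucc) (k j.succ)),
          (∏ j, y 0 ^ (k j.succ - 1 - m j)) *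
            (Matrix.of fun i j : Fin N => y i.succ ^ m j).det := by
    rw [← Matrix.det_transpose]
    have := (Matrix.detRowAlternating (R := R) (n := Fin N)).toMultilinearMap.map_sum_finset
      (fun (j : Fin N) (m : ℕ) => fun i : Fin N => y 0 ^ (k j.succ - 1 - m) * y i.succ ^ m)
      (fun j : Fin N => Finset.Ico (k j.castSucc) (k j.succ))
    convert this using 1
    · congr 1
      ext j i
      simp [Matrix.transpose_apply, Finset.sum_apply]
    · refine Finset.sum_congr rfl fun m _ => ?_
      rw [← Matrix.det_transpose, ← Matrix.det_mul_column]
      rfl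
  rw [h3]
  simp [B]

/-- coefficients -/
def lwD : ℕ → ℕ → ℤ
  | 0, 0 => 1
  | 0, _ + 1 => 0
  | 1, 0 => 1
  | 1, 1 => 1
  | 1, _ + 2 => 0
  | n + 2, 0 => lwD (n + 1) 0
  | n + 2, 1 => lwD (n + 1) 1
  | n + 2, k + 2 => lwD (n + 1) (k + 2) - lwD n k

lemma lwD_zero (n : ℕ) : lwD n 0 = 1 := by
  induction n using Nat.strong_induction_on with
  | _ n ih =>
    match n with
    | 0 => simp [lwD]
    | 1 => simp [lwD]
    | n + 2 => rw [lwD]; exact ih _ (by omega)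

lemma lwD_gt (n k : ℕ) (h : n < k) : lwD n k = 0 := by
  induction n using Nat.strong_induction_on generalizing k with
  | _ n ih =>
    match n, k with
    | 0, k + 1 => simp [lwD]
    | 1, k + 2 => simp [lwD]
    | n + 2, k + 2 => rw [lwD, ih (n+1) (by omega) _ (by omega), ih n (by omega) _ (by omega), sub_zero]

lemma lwD_sum {R : Type*} [CommRing R] (y w : R) (hw : w = 1 + y ^ 2) (n : ℕ) :
    1 - y ^ (2 * n + 1) = (1 - y) * ∑ k ∈ Finset.range (n + 1), (lwD n k : R) * y ^ k * w ^ (n - k) := by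
  induction n using Nat.strong_induction_on with
  | _ n ih =>
    match n with
    | 0 => simp [lwD]
    | 1 => simp [lwD, Finset.sum_range_succ, hw]; ring
    | n + 2 =>
      have h0 := ih n (by omega)
      have h1 := ih (n + 1) (by omega)
      have e1 : ∑ k ∈ Finset.range (n + 2 + 1), (lwD (n + 1) k : R) * y ^ k * w ^ (n + 2 - k)
          = w * ∑ k ∈ Finset.range (n + 1 + 1), (lwD (n + 1) k : R) * y ^ k * w ^ (n + 1 - k) := by
        rw [Finset.sum_range_succ, lwD_gt (n + 1) (n + 2) (by omega), Finset.mul_sum]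
        simp only [Int.cast_zero, zero_mul, add_zero]
        refine Finset.sum_congr rfl fun k hk => ?_
        rw [Finset.mem_range] at hk
        rw [show n + 2 - k = (n + 1 - k) + 1 by omega, pow_succ]; ring
      have e2 : ∑ k ∈ Finset.range (n + 2 + 1), (lwD (n + 2) k : R) * y ^ k * w ^ (n + 2 - k)
          = (∑ k ∈ Finset.range (n + 2 + 1), (lwD (n + 1) k : R) * y ^ k * w ^ (n + 2 - k))
           - y ^ 2 * ∑ k ∈ Finset.range (n + 1), (lwD n k : R) * y ^ k * w ^ (n - k) := by
        rw [Finset.sum_range_succ' _ (n + 2), Finset.sum_range_succ' _ (n + 1),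
          Finset.sum_range_succ' _ (n + 2), Finset.sum_range_succ' _ (n + 1), Finset.mul_sum]
        have : ∀ k, (lwD (n + 2) (k + 1 + 1) : R) * y ^ (k + 1 + 1) * w ^ (n + 2 - (k + 1 + 1))
          = (lwD (n + 1) (k + 1 + 1) : R) * y ^ (k + 1 + 1) * w ^ (n + 2 - (k + 1 + 1))
            - y ^ 2 * ((lwD n k : R) * y ^ k * w ^ (n - k)) := by
          intro k
          rw [show n + 2 - (k + 1 + 1) = n - k by omega, lwD]
          push_cast; ring
        simp only [this, Finset.sum_sub_distrib]
        simp only [lwD]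
        ring
      rw [e2, e1, mul_sub, mul_left_comm, ← h1, mul_left_comm, ← h0, hw]
      ring

lemma lw_denom {R : Type*} [CommRing R] (N : ℕ) (y : Fin N → R) :
    (Matrix.of fun i j : Fin N => y i ^ (j : ℕ) - y i ^ (2 * N - 1 - j)).det =
      (∏ i, (1 - y i)) * (∏ i, ∏ j ∈ Finset.Ioi i, (1 - y i * y j)) *
        (Matrix.vandermonde y).det := by
  let C : Matrix (Fin N) (Fin N) R := fun i j =>
    if j ≤ i then (lwD (N - 1 - j) (i - j) : R) else 0
  have hC : C.det = 1 := by
    rw [Matrix.det_of_isLowerTriangular]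
    · simp [C, lwD_zero]
    · intro i j hij
      have : i < j := hij
      simp [C, this]
  have hM : (Matrix.of fun i j : Fin N => y i ^ (j : ℕ) - y i ^ (2 * N - 1 - j)) =
      Matrix.of fun i j => (1 - y i) *
        (Matrix.projVandermonde y (fun i => 1 + y i ^ 2) * C) i j := by
    ext i j
    have hj := j.2
    rw [Matrix.of_apply, Matrix.of_apply, Matrix.mul_apply]
    have e : y i ^ (j : ℕ) - y i ^ (2 * N - 1 - j)
        = y i ^ (j : ℕ) * (1 - y i ^ (2 * (N - 1 - j) + 1)) := by
      rw [mul_sub, mul_one, ← pow_add]; congr 2; omega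
    rw [e, lwD_sum (y i) _ rfl, mul_left_comm]
    congr 1
    rw [Finset.mul_sum]
    let g : ℕ → R := fun m => if (j : ℕ) ≤ m then
      (y i ^ m * (1 + y i ^ 2) ^ (N - (m + 1))) * (lwD (N - 1 - j) (m - j) : R) else 0
    have e2 : ∑ m : Fin N, Matrix.projVandermonde y (fun i => 1 + y i ^ 2) i m * C m j
        = ∑ m ∈ Finset.range N, g m := by
      rw [← Fin.sum_univ_eq_sum_range]
      refine Finset.sum_congr rfl fun m _ => ?_
      simp only [Matrix.projVandermonde_apply, C, g, Fin.le_def, Fin.val_rev]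
      split_ifs <;> simp
    rw [e2, ← Finset.sum_range_add_sum_Ico g (show (j : ℕ) ≤ N from hj.le)]
    rw [Finset.sum_eq_zero (s := Finset.range j), zero_add, Finset.sum_Ico_eq_sum_range]
    · rw [show N - 1 - (j : ℕ) + 1 = N - j by omega]
      refine Finset.sum_congr rfl fun k hk => ?_
      rw [Finset.mem_range] at hk
      simp only [g, if_pos (Nat.le_add_right _ _)]
      rw [show N - 1 - (j : ℕ) - k = N - (j + k + 1) by omega, pow_add,
        Nat.add_sub_cancel_left]
      ring
    · intro m hm
      rw [Finset.mem_range] at hm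
      simp [g, hm]
  rw [hM, Matrix.det_mul_column, Matrix.det_mul, hC, mul_one, Matrix.det_projVandermonde,
    Matrix.det_vandermonde, mul_assoc]
  congr 1
  rw [← Finset.prod_mul_distrib]
  refine Finset.prod_congr rfl fun i _ => ?_
  rw [← Finset.prod_mul_distrib]
  refine Finset.prod_congr rfl fun j _ => ?_
  ring

lemma lw_fin (N : ℕ) (lam : YoungDiagram) :
    {T : SemistandardYoungTableau lam | ∀ i j : ℕ, (i, j) ∈ lam → T i j < N}.Finite := by
  rw [← Set.finite_coe_iff]
  refine Finite.of_injective (β := lam.cells → Fin N)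
    (fun T c => ⟨T.1 c.1.1 c.1.2, T.2 _ _ ((YoungDiagram.mem_cells _).1 c.2)⟩) ?_
  intro T T' h
  apply Subtype.ext
  ext i j
  by_cases hc : (i, j) ∈ lam
  · have := congrFun h ⟨(i, j), (YoungDiagram.mem_cells _).2 hc⟩
    simpa using this
  · rw [T.1.zeros hc, T'.1.zeros hc]

lemma lw_le_entry {lam : YoungDiagram} (T : SemistandardYoungTableau lam) (i j : ℕ)
    (h : (i, j) ∈ lam) : i ≤ T i j := by
  induction i with
  | zero => simp
  | succ i ih =>
    have := ih (lam.up_left_mem (Nat.le_succ i) le_rfl h)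
    have := T.col_strict (Nat.lt_add_one i) h
    omega

/-- truncation of a tableau -/
def lwTrunc {lam : YoungDiagram} (T : SemistandardYoungTableau lam) (N : ℕ) : YoungDiagram where
  cells := lam.cells.filter fun c => T c.1 c.2 < N
  isLowerSet := by
    rintro ⟨i, j⟩ ⟨i', j'⟩ ⟨h1, h2⟩ h
    simp only [Finset.coe_filter, YoungDiagram.mem_cells, Set.mem_ofPred_eq] at h ⊢
    simp only at h1 h2
    refine ⟨lam.up_left_mem h1 h2 h.1, ?_⟩
    have a := T.row_weak_of_le h2 (lam.up_left_mem h1 le_rfl h.1)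
    have b := T.col_weak h1 h.1
    omega

lemma mem_lwTrunc {lam : YoungDiagram} (T : SemistandardYoungTableau lam) (N i j : ℕ) :
    (i, j) ∈ lwTrunc T N ↔ (i, j) ∈ lam ∧ T i j < N := by
  rw [← YoungDiagram.mem_cells, lwTrunc, Finset.mem_filter, YoungDiagram.mem_cells]

/-- restriction of a tableau -/
def lwRestr {lam : YoungDiagram} (T : SemistandardYoungTableau lam) (mu : YoungDiagram)
    (h : mu ≤ lam) : SemistandardYoungTableau mu where
  entry i j := if (i, j) ∈ mu then T i j else 0
  row_weak' := by
    intro i j1 j2 hj hc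
    rw [if_pos hc, if_pos (mu.up_left_mem le_rfl hj.le hc)]
    exact T.row_weak hj (h hc)
  col_strict' := by
    intro i1 i2 j hi hc
    rw [if_pos hc, if_pos (mu.up_left_mem hi.le le_rfl hc)]
    exact T.col_strict hi (h hc)
  zeros' hc := if_neg hc

lemma lwRestr_apply {lam : YoungDiagram} (T : SemistandardYoungTableau lam) (mu : YoungDiagram)
    (h : mu ≤ lam) (i j : ℕ) : lwRestr T mu h i j = if (i, j) ∈ mu then T i j else 0 := rfl

/-- extension of a tableau -/
def lwExt {lam mu : YoungDiagram} (T : SemistandardYoungTableau mu) (N : ℕ)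
    (hT : ∀ i j : ℕ, (i, j) ∈ mu → T i j < N)
    (h2 : ∀ i, lam.rowLen (i + 1) ≤ mu.rowLen i) :
    SemistandardYoungTableau lam where
  entry i j := if (i, j) ∈ lam then (if (i, j) ∈ mu then T i j else N) else 0
  row_weak' := by
    intro i j1 j2 hj hc
    rw [if_pos hc, if_pos (lam.up_left_mem le_rfl hj.le hc)]
    by_cases hm : (i, j2) ∈ mu
    · rw [if_pos hm, if_pos (mu.up_left_mem le_rfl hj.le hm)]
      exact T.row_weak hj hm
    · rw [if_neg hm]
      split_ifs with h
      · exact (hT _ _ h).le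
      · exact le_rfl
  col_strict' := by
    intro i1 i2 j hi hc
    have hm1 : (i1, j) ∈ mu := by
      rw [YoungDiagram.mem_iff_lt_rowLen] at hc ⊢
      exact hc.trans_le ((lam.rowLen_anti _ _ hi).trans (h2 i1))
    rw [if_pos hc, if_pos (lam.up_left_mem hi.le le_rfl hc), if_pos hm1]
    by_cases hm : (i2, j) ∈ mu
    · rw [if_pos hm]
      exact T.col_strict hi hm
    · rw [if_neg hm]
      exact hT _ _ hm1
  zeros' hc := if_neg hc

lemma lwExt_apply {lam mu : YoungDiagram} (T : SemistandardYoungTableau mu) (N : ℕ)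
    (hT : ∀ i j : ℕ, (i, j) ∈ mu → T i j < N)
    (h2 : ∀ i, lam.rowLen (i + 1) ≤ mu.rowLen i) (i j : ℕ) :
    lwExt (lam := lam) T N hT h2 i j =
      if (i, j) ∈ lam then (if (i, j) ∈ mu then T i j else N) else 0 := rfl

/-- shapes interlacing with `lam` -/
def lwShapes (N : ℕ) (lam : YoungDiagram) : Set YoungDiagram :=
  {mu | mu ≤ lam ∧ mu.colLen 0 ≤ N ∧ ∀ i, lam.rowLen (i + 1) ≤ mu.rowLen i}

lemma lwShapes_fin (N : ℕ) (lam : YoungDiagram) : (lwShapes N lam).Finite := by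
  refine Set.Finite.of_finite_image (f := YoungDiagram.cells)
    ((lam.cells.powerset.finite_toSet).subset ?_) ?_
  · rintro _ ⟨mu, h, rfl⟩
    simpa using h.1
  · intro a _ b _ h
    exact YoungDiagram.ext h

lemma lw_schur_eq (N : ℕ) (lam : YoungDiagram) : schurPoly N lam =
    ∑ T ∈ (lw_fin N lam).toFinset, ∏ k : Fin N, (X k : MvPolynomial (Fin N) ℤ) ^
      ((lam.cells.filter fun c => T c.1 c.2 = (k : ℕ)).card) :=
  finsum_mem_eq_finite_toFinset_sum _ _

lemma lw_trunc_mem (N : ℕ) (lam : YoungDiagram) (T : SemistandardYoungTableau lam)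
    (hT : ∀ i j : ℕ, (i, j) ∈ lam → T i j < N + 1) : lwTrunc T N ∈ lwShapes N lam := by
  refine ⟨?_, ?_, ?_⟩
  · rintro ⟨i, j⟩ h
    exact ((mem_lwTrunc T N i j).1 ((YoungDiagram.mem_cells _).1 h)).1
  · by_contra! h
    rw [← YoungDiagram.mem_iff_lt_colLen, mem_lwTrunc] at h
    have := lw_le_entry T _ _ h.1
    omega
  · intro i
    by_contra! h
    have h1 := YoungDiagram.mem_iff_lt_rowLen.2 h
    have h2 : ¬ (i, (lwTrunc T N).rowLen i) ∈ lwTrunc T N := by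
      rw [YoungDiagram.mem_iff_lt_rowLen]; omega
    apply h2
    rw [mem_lwTrunc]
    refine ⟨lam.up_left_mem (Nat.le_succ i) le_rfl h1, ?_⟩
    have := hT _ _ h1
    have := T.col_strict (Nat.lt_add_one i) h1
    omega

lemma lw_schur_branch (N : ℕ) (lam : YoungDiagram) :
    schurPoly (N + 1) lam = ∑ mu ∈ (lwShapes_fin N lam).toFinset,
      X (Fin.last N) ^ (lam.card - mu.card) * rename Fin.castSucc (schurPoly N mu) := by
  classical
  rw [lw_schur_eq, ← Finset.sum_fiberwise_of_maps_to (t := (lwShapes_fin N lam).toFinset)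
    (g := fun T => lwTrunc T N)]
  swap
  · intro T hT
    rw [Set.Finite.mem_toFinset] at hT ⊢
    exact lw_trunc_mem N lam T hT
  refine Finset.sum_congr rfl fun mu hmu => ?_
  rw [Set.Finite.mem_toFinset] at hmu
  obtain ⟨h1, h3, h2⟩ := hmu
  rw [lw_schur_eq, map_sum, Finset.mul_sum]
  symm
  refine Finset.sum_bij' (fun T hT => lwExt (lam := lam) T N (by simpa using hT) h2)
    (fun T _ => lwRestr T mu h1) ?_ ?_ ?_ ?_ ?_
  · intro T hT
    have hT' : ∀ i j : ℕ, (i, j) ∈ mu → T i j < N := by simpa using hT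
    simp only [Finset.mem_filter, Set.Finite.mem_toFinset, Set.mem_ofPred_eq]
    constructor
    · intro i j hij
      rw [lwExt_apply, if_pos hij]
      split_ifs with h
      · exact (hT' _ _ h).trans (Nat.lt_succ_self N)
      · exact Nat.lt_succ_self N
    · apply YoungDiagram.ext
      ext ⟨i, j⟩
      rw [YoungDiagram.mem_cells, YoungDiagram.mem_cells, mem_lwTrunc, lwExt_apply]
      constructor
      · rintro ⟨h, h'⟩
        rw [if_pos h] at h'
        by_contra hn
        rw [if_neg hn] at h'
        omega
      · intro h
        have : (i, j) ∈ lam := h1 h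
        rw [if_pos this, if_pos h]
        exact ⟨this, hT' _ _ h⟩
  · intro T hT
    simp only [Finset.mem_filter, Set.Finite.mem_toFinset, Set.mem_ofPred_eq] at hT ⊢
    intro i j hij
    rw [lwRestr_apply, if_pos hij]
    rw [← hT.2, mem_lwTrunc] at hij
    exact hij.2
  · intro T hT
    ext i j
    rw [lwRestr_apply, lwExt_apply]
    split_ifs with h h'
    · rfl
    · exact absurd (h1 h) h'
    · exact (T.zeros h).symm
  · intro T hT
    simp only [Finset.mem_filter, Set.Finite.mem_toFinset, Set.mem_ofPred_eq] at hT
    ext i j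
    rw [lwExt_apply, lwRestr_apply]
    split_ifs with h h'
    · rfl
    · rw [← hT.2, mem_lwTrunc] at h'
      have := hT.1 _ _ h
      have : ¬ T i j < N := fun hh => h' ⟨h, hh⟩
      omega
    · exact (T.zeros h).symm
  · intro T hT
    have hT' : ∀ i j : ℕ, (i, j) ∈ mu → T i j < N := by simpa using hT
    rw [Fin.prod_univ_castSucc, map_prod, mul_comm]
    congr 1
    · refine Finset.prod_congr rfl fun k _ => ?_
      rw [map_pow, rename_X]
      congr 2
      ext ⟨i, j⟩
      rw [Finset.mem_filter, Finset.mem_filter]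
      simp only [YoungDiagram.mem_cells, lwExt_apply, Fin.val_castSucc]
      constructor
      · rintro ⟨h, h'⟩
        rw [if_pos (h1 h), if_pos h]
        exact ⟨h1 h, h'⟩
      · rintro ⟨h, h'⟩
        rw [if_pos h] at h'
        have := k.2
        split_ifs at h' with hm
        · exact ⟨hm, h'⟩
        · omega
    · congr 1
      rw [YoungDiagram.card, YoungDiagram.card,
        ← Finset.card_sdiff_of_subset (YoungDiagram.cells_subset_iff.2 h1)]
      congr 1
      ext ⟨i, j⟩
      rw [Finset.mem_filter, Finset.mem_sdiff]
      simp only [YoungDiagram.mem_cells, lwExt_apply, Fin.val_last]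
      constructor
      · rintro ⟨h, h'⟩
        rw [if_pos h, if_neg h']
        exact ⟨h, rfl⟩
      · rintro ⟨h, h'⟩
        refine ⟨h, fun hm => ?_⟩
        rw [if_pos h, if_pos hm] at h'
        have := hT' _ _ hm
        omega

lemma lw_rowLen_eq (mu : YoungDiagram) (i n : ℕ) (h : ∀ j, (i, j) ∈ mu ↔ j < n) :
    mu.rowLen i = n := by
  have h1 := h n
  have h2 := h (mu.rowLen i)
  rw [YoungDiagram.mem_iff_lt_rowLen] at h1 h2
  omega

lemma lw_ext_rowLen (mu nu : YoungDiagram) (h : ∀ i, mu.rowLen i = nu.rowLen i) : mu = nu := by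
  apply YoungDiagram.ext
  ext ⟨i, j⟩
  rw [YoungDiagram.mem_cells, YoungDiagram.mem_cells, YoungDiagram.mem_iff_lt_rowLen,
    YoungDiagram.mem_iff_lt_rowLen, h]

lemma lw_rowLen_zero (mu : YoungDiagram) (N i : ℕ) (h : mu.colLen 0 ≤ N) (hi : N ≤ i) :
    mu.rowLen i = 0 := by
  apply lw_rowLen_eq
  intro j
  simp only [Nat.not_lt_zero, iff_false]
  intro hm
  have := mu.up_left_mem le_rfl (Nat.zero_le j) hm
  rw [YoungDiagram.mem_iff_lt_colLen] at this
  omega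

lemma lw_card (mu : YoungDiagram) (N : ℕ) (h : mu.colLen 0 ≤ N) :
    mu.card = ∑ i : Fin N, mu.rowLen i := by
  rw [Fin.sum_univ_eq_sum_range (fun i => mu.rowLen i), YoungDiagram.card,
    Finset.card_eq_sum_card_fiberwise (f := Prod.fst) (t := Finset.range N)]
  · refine Finset.sum_congr rfl fun i _ => ?_
    rw [YoungDiagram.rowLen_eq_card]; rfl
  · rintro ⟨i, j⟩ hm
    have := mu.up_left_mem le_rfl (Nat.zero_le j) ((YoungDiagram.mem_cells _).1 hm)
    rw [YoungDiagram.mem_iff_lt_colLen] at this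
    simp; omega

lemma lw_exists (N : ℕ) (a : ℕ → ℕ) (ha : Antitone a) (hN : ∀ i, N ≤ i → a i = 0) :
    ∃ mu : YoungDiagram, mu.colLen 0 ≤ N ∧ ∀ i, mu.rowLen i = a i := by
  let mu : YoungDiagram :=
    { cells := (Finset.range N ×ˢ Finset.range (a 0)).filter fun c => c.2 < a c.1
      isLowerSet := by
        rintro ⟨i, j⟩ ⟨i', j'⟩ ⟨h1, h2⟩ h
        simp only [Finset.coe_filter, Finset.mem_product, Finset.mem_range,
          Set.mem_ofPred_eq] at h ⊢
        simp only at h1 h2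
        have := ha h1
        omega }
  have hm : ∀ i j, (i, j) ∈ mu ↔ j < a i := by
    intro i j
    rw [← YoungDiagram.mem_cells]
    simp only [mu, Finset.mem_filter, Finset.mem_product, Finset.mem_range]
    have h0 := ha (Nat.zero_le i)
    constructor
    · exact fun h => h.2
    · intro h
      refine ⟨⟨?_, by omega⟩, h⟩
      by_contra hi
      have := hN i (by omega)
      omega
  refine ⟨mu, ?_, fun i => lw_rowLen_eq _ _ _ (hm i)⟩
  by_contra! h
  rw [← YoungDiagram.mem_iff_lt_colLen, hm, hN N le_rfl] at h
  omega

/-- shifted parts -/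
def lwL (N : ℕ) (lam : YoungDiagram) (j : Fin N) : ℕ := lam.rowLen (Fin.rev j) + j

lemma lwL_strict (N : ℕ) (lam : YoungDiagram) : StrictMono (lwL N lam) := by
  intro i j h
  rw [Fin.lt_def] at h
  have := lam.rowLen_anti (Fin.rev j) (Fin.rev i) (by simp only [Fin.val_rev]; omega)
  simp only [lwL]
  omega

lemma lw_bialt_rev (N : ℕ) : ∀ lam : YoungDiagram, lam.colLen 0 ≤ N →
    schurPoly N lam * (Matrix.vandermonde (fun i : Fin N => (X i.rev : MvPolynomial (Fin N) ℤ))).det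
      = (Matrix.of fun i j : Fin N => (X i.rev : MvPolynomial (Fin N) ℤ) ^ lwL N lam j).det := by
  induction N with
  | zero =>
    intro lam h
    rw [Matrix.det_isEmpty, Matrix.det_isEmpty, mul_one, lw_schur_eq]
    have h0 : ∀ i j, (i, j) ∉ lam := by
      intro i j hm
      have := lam.up_left_mem le_rfl (Nat.zero_le j) hm
      rw [YoungDiagram.mem_iff_lt_colLen] at this
      omega
    have : (lw_fin 0 lam).toFinset = {default} := by
      ext T
      simp only [Set.Finite.mem_toFinset, Set.mem_ofPred_eq, Finset.mem_singleton]
      constructor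
      · intro _
        ext i j
        rw [T.zeros (h0 i j), SemistandardYoungTableau.zeros _ (h0 i j)]
      · intro _ i j hm
        exact absurd hm (h0 i j)
    rw [this]
    simp
  | succ N ih =>
    intro lam h
    rw [lw_det_branch N _ _ (lwL_strict _ _).monotone, lw_schur_branch]
    have hV : (Matrix.vandermonde (fun i : Fin (N + 1) =>
          (X i.rev : MvPolynomial (Fin (N + 1)) ℤ))).det
        = (∏ i : Fin N, (X i.succ.rev - X (0 : Fin (N + 1)).rev : MvPolynomial (Fin (N + 1)) ℤ)) *
          rename Fin.castSucc (Matrix.vandermonde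
            (fun i : Fin N => (X i.rev : MvPolynomial (Fin N) ℤ))).det := by
      rw [Matrix.det_vandermonde, Matrix.det_vandermonde, Fin.prod_univ_succ]
      congr 1
      · rw [Fin.Ioi_zero_eq_map, Finset.prod_map]
        rfl
      · rw [map_prod]
        refine Finset.prod_congr rfl fun i _ => ?_
        rw [map_prod, ← Fin.map_succEmb_Ioi, Finset.prod_map]
        refine Finset.prod_congr rfl fun j _ => ?_
        simp [Fin.rev_succ]
    rw [hV, mul_left_comm, mul_left_comm (X _ ^ _)]
    congr 1
    rw [Finset.sum_mul, Finset.mul_sum]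
    have hcard := lw_card lam (N + 1) h
    have hrev : ∀ f : Fin N → ℕ, ∑ i, f (Fin.rev i) = ∑ i, f i := fun f =>
      Equiv.sum_comp Fin.revPerm f
    refine Finset.sum_bij (fun mu _ => lwL N mu) ?_ ?_ ?_ ?_
    · intro mu hmu
      rw [Set.Finite.mem_toFinset] at hmu
      obtain ⟨h1, h3, h2⟩ := hmu
      rw [Fintype.mem_piFinset]
      intro j
      rw [Finset.mem_Ico]
      have a1 := h2 (Fin.rev j)
      have a2 : mu.rowLen (Fin.rev j) ≤ lam.rowLen (Fin.rev j) := by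
        by_contra! hh
        rw [← YoungDiagram.mem_iff_lt_rowLen] at hh
        have := h1 hh
        have : (_, _) ∈ lam := this
        rw [YoungDiagram.mem_iff_lt_rowLen] at this
        omega
      simp only [lwL, Fin.rev_castSucc, Fin.val_succ, Fin.val_castSucc, Fin.rev_succ] at *
      omega
    · intro mu hmu nu hnu he
      rw [Set.Finite.mem_toFinset] at hmu hnu
      apply lw_ext_rowLen
      intro i
      by_cases hi : i < N
      · have := congrFun he (Fin.rev ⟨i, hi⟩)
        simp only [lwL, Fin.rev_rev] at this
        omega
      · rw [lw_rowLen_zero mu N i hmu.2.1 (by omega), lw_rowLen_zero nu N i hnu.2.1 (by omega)]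
    · intro m hm
      rw [Fintype.mem_piFinset] at hm
      have hm' : ∀ j : Fin N, lam.rowLen (Fin.rev j + 1) + j ≤ m j ∧
          m j ≤ lam.rowLen (Fin.rev j) + j := by
        intro j
        have := hm j
        rw [Finset.mem_Ico] at this
        simp only [lwL, Fin.rev_castSucc, Fin.val_succ, Fin.val_castSucc, Fin.rev_succ] at this
        omega
      let a : ℕ → ℕ := fun i => if h : i < N then m (Fin.rev ⟨i, h⟩) - (N - 1 - i) else 0
      have ha1 : ∀ i (h : i < N), lam.rowLen (i + 1) ≤ a i ∧ a i ≤ lam.rowLen i ∧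
          a i + (N - 1 - i) = m (Fin.rev ⟨i, h⟩) := by
        intro i hi
        have := hm' (Fin.rev ⟨i, hi⟩)
        simp only [Fin.rev_rev] at this
        simp only [a, dif_pos hi]
        rw [Fin.val_rev] at this
        simp only at this
        rw [show N - (i + 1) = N - 1 - i by omega] at this
        omega
      have ha0 : ∀ i, N ≤ i → a i = 0 := fun i hi => dif_neg (by omega)
      have hlam0 : ∀ i, N < i → lam.rowLen i = 0 := fun i hi => lw_rowLen_zero lam _ i h hi
      obtain ⟨mu, hmuN, hmu⟩ := lw_exists N a (by
        refine antitone_nat_of_succ_le fun i => ?_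
        by_cases hi : i + 1 < N
        · have := ha1 i (by omega)
          have := ha1 (i + 1) hi
          omega
        · rw [ha0 _ (by omega)]; omega) ha0
      refine ⟨mu, ?_, ?_⟩
      · rw [Set.Finite.mem_toFinset]
        refine ⟨?_, hmuN, ?_⟩
        · rintro ⟨i, j⟩ hij
          have hij : (i, j) ∈ mu := hij
          show (i, j) ∈ lam
          rw [YoungDiagram.mem_iff_lt_rowLen, hmu] at hij
          rw [YoungDiagram.mem_iff_lt_rowLen]
          by_cases hi : i < N
          · have := ha1 i hi
            omega
          · rw [ha0 _ (by omega)] at hij; omega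
        · intro i
          rw [hmu]
          by_cases hi : i < N
          · exact (ha1 i hi).1
          · rw [hlam0 _ (by omega)]; omega
      · funext j
        have := ha1 (Fin.rev j) (Fin.rev j).2
        simp only [Fin.eta, Fin.rev_rev] at this
        rw [lwL, hmu, ← this.2.2]
        simp only [Fin.val_rev]
        have := j.2
        omega
    · intro mu hmu
      rw [Set.Finite.mem_toFinset] at hmu
      obtain ⟨h1, h3, h2⟩ := hmu
      have a2 : ∀ i, mu.rowLen i ≤ lam.rowLen i := by
        intro i
        by_contra! hh
        rw [← YoungDiagram.mem_iff_lt_rowLen] at hh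
        have := h1 hh
        have : (_, _) ∈ lam := this
        rw [YoungDiagram.mem_iff_lt_rowLen] at this
        omega
      rw [mul_assoc, ← map_mul, ih mu h3, ← mul_assoc]
      congr 1
      · rw [Finset.prod_pow_eq_pow_sum, ← pow_add]
        rw [Fin.rev_zero]
        congr 1
        rw [hcard, lw_card mu N h3, Fin.sum_univ_castSucc]
        have e1 : ∑ j : Fin N, (lwL (N + 1) lam j.succ - 1 - lwL N mu j)
            = ∑ j : Fin N, (lam.rowLen j - mu.rowLen j) := by
          rw [← hrev (fun j => lam.rowLen j - mu.rowLen j)]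
          refine Finset.sum_congr rfl fun j _ => ?_
          simp only [lwL, Fin.rev_succ, Fin.val_castSucc, Fin.val_succ]
          omega
        rw [e1, Finset.sum_tsub_distrib (f := fun j : Fin N => lam.rowLen j)
          (g := fun j : Fin N => mu.rowLen j) _ (fun i _ => a2 i)]
        have e2 : ∑ j : Fin N, mu.rowLen j ≤ ∑ j : Fin N, lam.rowLen j :=
          Finset.sum_le_sum fun i _ => a2 i
        simp only [lwL, Fin.rev_zero, Fin.val_last, Fin.val_zero, Fin.val_castSucc]
        omega
      · rw [AlgHom.map_det]
        congr 1
        ext1 i j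
        simp [Fin.rev_succ]

lemma lw_bialt (N : ℕ) (lam : YoungDiagram) (h : lam.colLen 0 ≤ N) :
    schurPoly N lam * (Matrix.vandermonde (fun i : Fin N => (X i : MvPolynomial (Fin N) ℤ))).det
      = (Matrix.of fun i j : Fin N => (X i : MvPolynomial (Fin N) ℤ) ^ lwL N lam j).det := by
  have := lw_bialt_rev N lam h
  have e1 : Matrix.vandermonde (fun i : Fin N => (X i.rev : MvPolynomial (Fin N) ℤ)) =
    (Matrix.vandermonde (fun i : Fin N => (X i : MvPolynomial (Fin N) ℤ))).submatrix
      Fin.revPerm id := by ext1 i j; simp [Matrix.vandermonde_apply]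
  have e2 : (Matrix.of fun i j : Fin N => (X i.rev : MvPolynomial (Fin N) ℤ) ^ lwL N lam j) =
    (Matrix.of fun i j : Fin N => (X i : MvPolynomial (Fin N) ℤ) ^ lwL N lam j).submatrix
      Fin.revPerm id := by ext1 i j; simp
  rw [e1, e2, Matrix.det_permute, Matrix.det_permute] at this
  rcases Int.units_eq_one_or (Equiv.Perm.sign (Fin.revPerm (n := N))) with hs | hs <;>
    simpa [hs] using this

/-- exponents chosen by a subset -/
def lwE (N : ℕ) (S : Finset (Fin N)) (j : Fin N) : ℕ := if j ∈ S then 2 * N - 1 - j else j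

lemma lw_expand {R : Type*} [CommRing R] (N : ℕ) (y : Fin N → R) :
    (Matrix.of fun i j : Fin N => y i ^ (j : ℕ) - y i ^ (2 * N - 1 - j)).det =
      ∑ S : Finset (Fin N), (-1) ^ S.card * (Matrix.of fun i j : Fin N => y i ^ lwE N S j).det := by
  classical
  rw [← Matrix.det_transpose]
  have := (Matrix.detRowAlternating (R := R) (n := Fin N)).toMultilinearMap.map_add_univ
      (fun (j : Fin N) => fun i : Fin N => - y i ^ (2 * N - 1 - j))
      (fun (j : Fin N) => fun i : Fin N => y i ^ (j : ℕ))
  convert this using 1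
  · congr 1
    ext j i
    simp [Matrix.transpose_apply]; ring
  · refine Finset.sum_congr rfl fun S _ => ?_
    have e : (-1 : R) ^ S.card = ∏ j : Fin N, if j ∈ S then (-1 : R) else 1 := by
      simp [Finset.prod_ite_mem]
    rw [← Matrix.det_transpose, e, ← Matrix.det_mul_column]
    show Matrix.det _ = Matrix.det _
    congr 1
    ext j i
    simp only [Matrix.of_apply, Matrix.transpose_apply, Finset.piecewise, lwE]
    split_ifs <;> simp

lemma lw_pair (N : ℕ) (l : Fin N → ℕ) (hinj : Function.Injective l) (hb : ∀ i, l i < 2 * N)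
    (hp : ∀ i j, l i + l j ≠ 2 * N - 1) :
    ∃ τ : Equiv.Perm (Fin N), ∀ i, l i = τ i ∨ l i = 2 * N - 1 - τ i := by
  let f : Fin N → Fin N := fun i => if h : l i < N then ⟨l i, h⟩ else
    ⟨2 * N - 1 - l i, by have := hb i; omega⟩
  have hf : ∀ i, (f i : ℕ) = if l i < N then l i else 2 * N - 1 - l i := by
    intro i
    simp only [f]
    split_ifs <;> rfl
  have hfi : Function.Injective f := by
    intro i j hij
    apply hinj
    have h := congrArg Fin.val hij
    rw [hf, hf] at h
    have := hb i
    have := hb j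
    have := hp i j
    split_ifs at h <;> omega
  refine ⟨Equiv.ofBijective f (Finite.injective_iff_bijective.1 hfi), fun i => ?_⟩
  rw [Equiv.ofBijective_apply, hf]
  have := hb i
  split_ifs <;> omega

open Classical in
/-- subset attached to exponents -/
noncomputable def lwS (N : ℕ) (l : Fin N → ℕ) : Finset (Fin N) :=
  Finset.univ.filter fun j => ∃ i, l i = 2 * N - 1 - j

lemma lw_pairS (N : ℕ) (l : Fin N → ℕ) (hinj : Function.Injective l) (hb : ∀ i, l i < 2 * N)
    (hp : ∀ i j, l i + l j ≠ 2 * N - 1) :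
    ∃ τ : Equiv.Perm (Fin N), ∀ i, lwE N (lwS N l) (τ i) = l i := by
  obtain ⟨τ, hτ⟩ := lw_pair N l hinj hb hp
  refine ⟨τ, fun i => ?_⟩
  simp only [lwE, lwS, Finset.mem_filter, Finset.mem_univ, true_and]
  have := (τ i).2
  split_ifs with h
  · obtain ⟨i', h'⟩ := h
    have := hp i i'
    rcases hτ i with h1 | h1 <;> omega
  · rcases hτ i with h1 | h1
    · exact h1.symm
    · exact absurd ⟨i, h1⟩ h

lemma lw_sign {R : Type*} [CommRing R] (N : ℕ) (y : Fin N → R) (S : Finset (Fin N))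
    (l : Fin N → ℕ) (hl : StrictMono l) (τ : Equiv.Perm (Fin N))
    (hτ : ∀ i, lwE N S (τ i) = l i) :
    (Matrix.of fun i j : Fin N => y i ^ lwE N S j).det =
      (∏ j ∈ S, (-1) ^ (N - 1 - j : ℕ)) * (Matrix.of fun i j : Fin N => y i ^ l j).det := by
  have e : (Matrix.of fun i j : Fin N => y i ^ lwE N S j) =
      (Matrix.of fun i j : Fin N => y i ^ l j).submatrix id (τ⁻¹ : Equiv.Perm (Fin N)) := by
    ext1 i j
    simp [← hτ]
  rw [e, Matrix.det_permute']
  congr 1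
  rw [Equiv.Perm.sign_eq_prod_prod_Ioi]
  have h1 : ∀ i : Fin N, ∏ j ∈ Finset.Ioi i, (if τ⁻¹ i < τ⁻¹ j then (1 : ℤˣ) else -1) =
      if i ∈ S then (-1) ^ (N - 1 - i : ℕ) else 1 := by
    intro i
    have h2 : ∀ j ∈ Finset.Ioi i, (if τ⁻¹ i < τ⁻¹ j then (1 : ℤˣ) else -1) =
        if i ∈ S then -1 else 1 := by
      intro j hj
      rw [Finset.mem_Ioi, Fin.lt_def] at hj
      have a := hτ (τ⁻¹ i)
      have b := hτ (τ⁻¹ j)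
      rw [show τ (τ⁻¹ i) = i from τ.apply_symm_apply i] at a
      rw [show τ (τ⁻¹ j) = j from τ.apply_symm_apply j] at b
      have : τ⁻¹ i < τ⁻¹ j ↔ ¬ i ∈ S := by
        rw [← hl.lt_iff_lt, ← a, ← b]
        have := i.2
        have := j.2
        simp only [lwE]
        split_ifs with c d d <;> simp only [c, not_true_eq_false, not_false_eq_true, iff_false, iff_true] <;> omega
      simp only [this]
      by_cases hi : i ∈ S <;> simp [hi]
    rw [Finset.prod_congr rfl h2, Finset.prod_const, Fin.card_Ioi]
    split_ifs <;> simp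
  rw [Finset.prod_congr rfl fun i _ => h1 i, Finset.prod_ite_mem, Finset.univ_inter]
  push_cast
  rfl

lemma lw_sc (N : ℕ) (lam : YoungDiagram) (ht : lam.transpose = lam) (h : lam.colLen 0 ≤ N) :
    (∀ i, lwL N lam i < 2 * N) ∧ ∀ i j, lwL N lam i + lwL N lam j ≠ 2 * N - 1 := by
  constructor
  · intro i
    have h1 := lam.rowLen_anti 0 (Fin.rev i) (Nat.zero_le _)
    have h2 : lam.rowLen 0 = lam.colLen 0 := by
      rw [← YoungDiagram.rowLen_transpose, ht]
    simp only [lwL]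
    omega
  · intro i j
    have h1 : ((Fin.rev i : ℕ), (Fin.rev j : ℕ)) ∈ lam ↔ ((Fin.rev j : ℕ), (Fin.rev i : ℕ)) ∈ lam := by
      conv_lhs => rw [← ht, YoungDiagram.mem_transpose]
      rfl
    rw [YoungDiagram.mem_iff_lt_rowLen, YoungDiagram.mem_iff_lt_rowLen] at h1
    simp only [lwL]
    have := Fin.val_rev i
    have := Fin.val_rev j
    omega

lemma lw_L_inj (N : ℕ) (mu nu : YoungDiagram) (hmu : mu.colLen 0 ≤ N) (hnu : nu.colLen 0 ≤ N)
    (h : lwL N mu = lwL N nu) : mu = nu := by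
  apply lw_ext_rowLen
  intro i
  by_cases hi : i < N
  · have := congrFun h (Fin.rev ⟨i, hi⟩)
    simp only [lwL, Fin.rev_rev] at this
    omega
  · rw [lw_rowLen_zero mu N i hmu (by omega), lw_rowLen_zero nu N i hnu (by omega)]

lemma lw_surj (N : ℕ) (S : Finset (Fin N)) : ∃ lam : YoungDiagram,
    (lam.transpose = lam ∧ lam.colLen 0 ≤ N) ∧ lwS N (lwL N lam) = S := by
  classical
  have hEi : Function.Injective (lwE N S) := by
    intro i j h
    have := i.2
    have := j.2
    simp only [lwE] at h
    ext
    split_ifs at h <;> omega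
  have hcard : (Finset.univ.image (lwE N S)).card = N := by
    rw [Finset.card_image_of_injective _ hEi]; simp
  let l : Fin N → ℕ := (Finset.univ.image (lwE N S)).orderEmbOfFin hcard
  have hl : StrictMono l := ((Finset.univ.image (lwE N S)).orderEmbOfFin hcard).strictMono
  have hlr : Set.range l = Set.range (lwE N S) := by
    simp [l]
  have hlE : ∀ i, ∃ j, lwE N S j = l i := fun i => by
    have : l i ∈ Set.range l := ⟨i, rfl⟩
    rw [hlr] at this; exact this
  have hEl : ∀ j, ∃ i, l i = lwE N S j := fun j => by
    have : lwE N S j ∈ Set.range (lwE N S) := ⟨j, rfl⟩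
    rw [← hlr] at this; exact this
  have hb : ∀ i, l i < 2 * N := by
    intro i
    obtain ⟨j, hj⟩ := hlE i
    have := j.2
    rw [← hj]; simp only [lwE]; split_ifs <;> omega
  have hp : ∀ i j, l i + l j ≠ 2 * N - 1 := by
    intro i j
    obtain ⟨i', hi⟩ := hlE i
    obtain ⟨j', hj⟩ := hlE j
    have := i'.2
    have := j'.2
    rw [← hi, ← hj]
    by_cases hij : i' = j'
    · subst hij
      omega
    · have : (i' : ℕ) ≠ j' := fun h => hij (Fin.ext h)
      simp only [lwE]; split_ifs <;> omega
  obtain ⟨τ, hτ⟩ := lw_pair N l hl.injective hb hp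
  have hcount : ∀ j, (Finset.univ.filter fun i => 2 * N ≤ l i + l j).card + j = l j := by
    intro j
    have hd : Disjoint
        ((Finset.univ.filter fun i => 2 * N ≤ l i + l j).image fun i => 2 * N - 1 - l i)
        ((Finset.univ.filter fun i => i < j).image l) := by
      rw [Finset.disjoint_left]
      intro v hv hv'
      simp only [Finset.mem_image, Finset.mem_filter, Finset.mem_univ, true_and] at hv hv'
      obtain ⟨a, ha, rfl⟩ := hv
      obtain ⟨b, hb', hab⟩ := hv'
      have := hp a b
      have := hb a
      omega
    have hu : ((Finset.univ.filter fun i => 2 * N ≤ l i + l j).image fun i => 2 * N - 1 - l i) ∪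
        ((Finset.univ.filter fun i => i < j).image l) = Finset.range (l j) := by
      ext v
      simp only [Finset.mem_union, Finset.mem_image, Finset.mem_filter, Finset.mem_univ, true_and,
        Finset.mem_range]
      constructor
      · rintro (⟨a, ha, rfl⟩ | ⟨a, ha, rfl⟩)
        · have := hb a
          omega
        · exact hl ha
      · intro hv
        have hbj := hb j
        by_cases hvN : v < N
        · have := hτ (τ.symm ⟨v, hvN⟩)
          simp only [Equiv.apply_symm_apply] at this
          rcases this with h | h
          · right
            exact ⟨_, hl.lt_iff_lt.1 (by omega), h⟩
          · left
            exact ⟨τ.symm ⟨v, hvN⟩, by omega, by omega⟩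
        · have := hτ (τ.symm ⟨2 * N - 1 - v, by omega⟩)
          simp only [Equiv.apply_symm_apply] at this
          rcases this with h | h
          · left
            exact ⟨τ.symm ⟨2 * N - 1 - v, by omega⟩, by omega, by omega⟩
          · right
            exact ⟨τ.symm ⟨2 * N - 1 - v, by omega⟩, hl.lt_iff_lt.1 (by omega), by omega⟩
    have hc := congrArg Finset.card hu
    rw [Finset.card_union_of_disjoint hd, Finset.card_range, Finset.card_image_of_injOn,
      Finset.card_image_of_injective _ hl.injective] at hc
    · have : (Finset.univ.filter fun i : Fin N => i < j).card = j := by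
        rw [Finset.filter_gt_eq_Iio, Fin.card_Iio]
      rw [this] at hc
      exact hc
    · intro a _ b _ hab
      have := hb a
      have := hb b
      simp only at hab
      exact hl.injective (by omega)
  let g : ℕ → ℕ := fun a => if h : a < N then l (Fin.rev ⟨a, h⟩) else 0
  have hg : ∀ i : Fin N, g (Fin.rev i) = l i := by
    intro i
    simp only [g, dif_pos (Fin.rev i).2, Fin.eta, Fin.rev_rev]
  have hga : ∀ a b, a ≤ b → g b ≤ g a := by
    intro a b hab
    simp only [g]
    split_ifs with h1 h2 h2
    · apply hl.monotone
      rw [Fin.rev_le_rev]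
      exact hab
    · omega
    · omega
    · omega
  let lam : YoungDiagram :=
    { cells := (Finset.range N ×ˢ Finset.range N).filter fun c => 2 * N ≤ g c.1 + g c.2
      isLowerSet := by
        rintro ⟨i, j⟩ ⟨i', j'⟩ ⟨h1, h2⟩ h
        simp only [Finset.coe_filter, Finset.mem_product, Finset.mem_range,
          Set.mem_ofPred_eq] at h ⊢
        simp only at h1 h2
        have := hga _ _ h1
        have := hga _ _ h2
        omega }
  have hm : ∀ i j, (i, j) ∈ lam ↔ (i < N ∧ j < N) ∧ 2 * N ≤ g i + g j := by
    intro i j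
    rw [← YoungDiagram.mem_cells]
    simp only [lam, Finset.mem_filter, Finset.mem_product, Finset.mem_range]
  have hL : lwL N lam = l := by
    funext j
    rw [lwL, ← hcount j, YoungDiagram.rowLen_eq_card]
    congr 1
    symm
    refine Finset.card_bij (fun i _ => ((Fin.rev j : ℕ), (Fin.rev i : ℕ))) ?_ ?_ ?_
    · intro i hi
      rw [Finset.mem_filter] at hi
      rw [YoungDiagram.mk_mem_row_iff, hm, hg, hg]
      exact ⟨⟨Fin.is_lt _, Fin.is_lt _⟩, by omega⟩
    · intro a _ b _ hab
      have := (Prod.mk.inj hab).2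
      exact Fin.rev_injective (Fin.ext this)
    · rintro ⟨a, b⟩ hab
      rw [YoungDiagram.mem_row_iff] at hab
      obtain ⟨h1, h2⟩ := hab
      simp only at h2
      subst h2
      rw [hm] at h1
      obtain ⟨⟨_, hbN⟩, h1⟩ := h1
      have hb2 := hg (Fin.rev ⟨b, hbN⟩)
      rw [Fin.rev_rev] at hb2
      simp only at hb2
      refine ⟨Fin.rev ⟨b, hbN⟩, ?_, ?_⟩
      · rw [Finset.mem_filter]
        rw [hg] at h1
        exact ⟨Finset.mem_univ _, by omega⟩
      · rw [Fin.rev_rev]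
  refine ⟨lam, ⟨?_, ?_⟩, ?_⟩
  · apply YoungDiagram.ext
    ext ⟨i, j⟩
    rw [YoungDiagram.mem_cells, YoungDiagram.mem_cells, YoungDiagram.mem_transpose]
    show (j, i) ∈ lam ↔ _
    rw [hm, hm, add_comm, and_comm (a := j < N)]
  · by_contra! h
    rw [← YoungDiagram.mem_iff_lt_colLen, hm] at h
    omega
  · rw [hL]
    ext j
    have hj := j.2
    simp only [lwS, Finset.mem_filter, Finset.mem_univ, true_and]
    constructor
    · rintro ⟨i, hi⟩
      obtain ⟨j', hj'⟩ := hlE i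
      have := j'.2
      rw [hi] at hj'
      simp only [lwE] at hj'
      split_ifs at hj' with h
      · have : j' = j := Fin.ext (by omega)
        rwa [← this]
      · omega
    · intro h
      obtain ⟨i, hi⟩ := hEl j
      exact ⟨i, by rw [hi, lwE, if_pos h]⟩

lemma lw_exponent (N : ℕ) (lam : YoungDiagram) (h : lam.colLen 0 ≤ N)
    (S : Finset (Fin N)) (τ : Equiv.Perm (Fin N)) (hτ : ∀ i, lwE N S (τ i) = lwL N lam i) :
    (lam.card + lam.diagRank) / 2 = ∑ j ∈ S, (N - j : ℕ) := by
  have hr : lam.diagRank = S.card := by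
    rw [YoungDiagram.diagRank]
    symm
    refine Finset.card_bij (fun j _ => ((Fin.rev (τ.symm j) : ℕ), (Fin.rev (τ.symm j) : ℕ))) ?_ ?_ ?_
    · intro j hj
      have := hτ (τ.symm j)
      rw [Equiv.apply_symm_apply, lwE, if_pos hj, lwL] at this
      rw [Finset.mem_filter, YoungDiagram.mem_cells, YoungDiagram.mem_iff_lt_rowLen]
      refine ⟨?_, rfl⟩
      have := j.2
      have := Fin.val_rev (τ.symm j)
      omega
    · intro a _ b _ hab
      have := (Prod.mk.inj hab).1
      exact τ.symm.injective (Fin.rev_injective (Fin.ext this))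
    · rintro ⟨a, b⟩ hab
      rw [Finset.mem_filter, YoungDiagram.mem_cells] at hab
      obtain ⟨h1, h2⟩ := hab
      simp only at h2
      subst h2
      have haN : a < N := by
        have := lam.up_left_mem le_rfl (Nat.zero_le a) h1
        rw [YoungDiagram.mem_iff_lt_colLen] at this
        omega
      refine ⟨τ (Fin.rev ⟨a, haN⟩), ?_, by simp⟩
      have := hτ (Fin.rev ⟨a, haN⟩)
      rw [YoungDiagram.mem_iff_lt_rowLen] at h1
      by_contra hS
      rw [lwE, if_neg hS, lwL, Fin.rev_rev] at this
      have := (τ (Fin.rev ⟨a, haN⟩)).2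
      have := Fin.val_rev (⟨a, haN⟩ : Fin N)
      simp only at *
      omega
  have h1 : ∑ i, lwL N lam i = lam.card + ∑ i : Fin N, (i : ℕ) := by
    simp only [lwL, Finset.sum_add_distrib]
    rw [lw_card lam N h]
    congr 1
    exact Equiv.sum_comp Fin.revPerm (fun i : Fin N => lam.rowLen i)
  have h2 : ∑ i, lwL N lam i = ∑ j, lwE N S j := by
    rw [← Equiv.sum_comp τ (lwE N S)]
    exact Finset.sum_congr rfl fun i _ => (hτ i).symm
  have h3 : ∑ j, lwE N S j = (∑ j ∈ S, (2 * N - 1 - 2 * j : ℕ)) + ∑ i : Fin N, (i : ℕ) := by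
    rw [← Finset.univ_inter S, ← Finset.sum_ite_mem, Finset.univ_inter, ← Finset.sum_add_distrib]
    refine Finset.sum_congr rfl fun j _ => ?_
    have := j.2
    simp only [lwE]
    split_ifs <;> omega
  have h4 : lam.card + lam.diagRank = 2 * ∑ j ∈ S, (N - j : ℕ) := by
    rw [hr, Finset.card_eq_sum_ones, show lam.card = ∑ j ∈ S, (2 * N - 1 - 2 * j : ℕ) by omega,
      ← Finset.sum_add_distrib, Finset.mul_sum]
    refine Finset.sum_congr rfl fun j _ => ?_
    have := j.2
    omega
  omega

lemma lw_sc_fin (N : ℕ) :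
    {lam : YoungDiagram | lam.transpose = lam ∧ lam.colLen 0 ≤ N}.Finite := by
  refine Set.Finite.of_finite_image (f := YoungDiagram.cells)
    (((Finset.range N ×ˢ Finset.range N).powerset.finite_toSet).subset ?_) ?_
  · rintro _ ⟨mu, ⟨ht, h⟩, rfl⟩
    simp only [Finset.coe_powerset, Set.mem_preimage, Set.mem_powerset_iff, Finset.coe_subset]
    rintro ⟨i, j⟩ hij
    rw [YoungDiagram.mem_cells] at hij
    have h1 := mu.up_left_mem le_rfl (Nat.zero_le j) hij
    have h2 : (j, i) ∈ mu := by
      rw [← ht, YoungDiagram.mem_transpose]; exact hij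
    have h3 := mu.up_left_mem le_rfl (Nat.zero_le i) h2
    rw [YoungDiagram.mem_iff_lt_colLen] at h1 h3
    simp; omega
  · intro a _ b _ h
    exact YoungDiagram.ext h

/-- **Littlewood's identity** (finite-variable form):
`∏ᵢ (1 - xᵢ) ∏_{i<j} (1 - xᵢxⱼ) = Σ_{λ = λ'} (-1)^{(|λ|+r(λ))/2} s_λ(x)`,
the sum running over all self-conjugate Young diagrams with at most `N` rows. -/
theorem littlewood_identity (N : ℕ) (hN : 0 < N) :
    (∏ i : Fin N, (1 - X i : MvPolynomial (Fin N) ℤ)) *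
      (∏ p ∈ Finset.univ.filter (fun p : Fin N × Fin N => p.1 < p.2),
        (1 - X p.1 * X p.2 : MvPolynomial (Fin N) ℤ)) =
    ∑ᶠ lam ∈ {lam : YoungDiagram | lam.transpose = lam ∧ lam.colLen 0 ≤ N},
      (-1 : MvPolynomial (Fin N) ℤ) ^ ((lam.card + lam.diagRank) / 2) * schurPoly N lam := by
  classical
  set V := (Matrix.vandermonde (fun i : Fin N => (X i : MvPolynomial (Fin N) ℤ))).det with hVdef
  have hV : V ≠ 0 := Matrix.det_vandermonde_ne_zero_iff.2 (X_injective (σ := Fin N) (R := ℤ))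
  apply mul_right_cancel₀ hV
  have hprod : (∏ p ∈ Finset.univ.filter (fun p : Fin N × Fin N => p.1 < p.2),
        (1 - X p.1 * X p.2 : MvPolynomial (Fin N) ℤ)) =
      ∏ i, ∏ j ∈ Finset.Ioi i, (1 - X i * X j : MvPolynomial (Fin N) ℤ) := by
    rw [Finset.prod_filter, Fintype.prod_prod_type]
    refine Finset.prod_congr rfl fun i _ => ?_
    rw [← Finset.prod_filter, Finset.filter_lt_eq_Ioi]
  rw [hprod, hVdef, ← lw_denom, lw_expand, finsum_mem_eq_finite_toFinset_sum _ (lw_sc_fin N),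
    Finset.sum_mul]
  symm
  refine Finset.sum_bij (fun lam _ => lwS N (lwL N lam)) ?_ ?_ ?_ ?_
  · intro lam _
    exact Finset.mem_univ _
  · intro mu hmu nu hnu he
    rw [Set.Finite.mem_toFinset] at hmu hnu
    obtain ⟨b1, p1⟩ := lw_sc N mu hmu.1 hmu.2
    obtain ⟨b2, p2⟩ := lw_sc N nu hnu.1 hnu.2
    obtain ⟨τ, hτ⟩ := lw_pairS N _ (lwL_strict N mu).injective b1 p1
    obtain ⟨ρ, hρ⟩ := lw_pairS N _ (lwL_strict N nu).injective b2 p2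
    apply lw_L_inj N mu nu hmu.2 hnu.2
    apply ((lwL_strict N mu).range_inj (lwL_strict N nu)).1
    have r1 : lwL N mu = lwE N (lwS N (lwL N mu)) ∘ τ := funext fun i => (hτ i).symm
    have r2 : lwL N nu = lwE N (lwS N (lwL N nu)) ∘ ρ := funext fun i => (hρ i).symm
    rw [r1, r2, τ.surjective.range_comp, ρ.surjective.range_comp, he]
  · intro S _
    obtain ⟨lam, h1, h2⟩ := lw_surj N S
    exact ⟨lam, (Set.Finite.mem_toFinset _).2 h1, h2⟩
  · intro lam hlam
    rw [Set.Finite.mem_toFinset] at hlam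
    obtain ⟨b1, p1⟩ := lw_sc N lam hlam.1 hlam.2
    obtain ⟨τ, hτ⟩ := lw_pairS N _ (lwL_strict N lam).injective b1 p1
    rw [lw_sign N _ _ _ (lwL_strict N lam) τ hτ, mul_assoc, lw_bialt N lam hlam.2, ← mul_assoc,
      lw_exponent N lam hlam.2 _ τ hτ]
    congr 1
    rw [Finset.prod_pow_eq_pow_sum, ← pow_add, Finset.card_eq_sum_ones, ← Finset.sum_add_distrib]
    congr 1
    refine Finset.sum_congr rfl fun j _ => ?_
    have := j.2
    omega
end

section
/- Cauchy–Littlewood character identity for the parastatistics algebra, in coefficient form: for every positive integer N and every function m : {0,…,N−1} → ℕ, the number of semistandard Young tableaux (of arbitrary shape) with entries in {0,…,N−1} and content m (i.e., exactly m(i) entries equal to i) equals the number of pairs (f,g), where f : {0,…,N−1} → ℕ and g assigns a natural number to each pair (i,j) with i<j, such that for every k one has m(k) = f(k) + Σ_{j>k} g(k,j) + Σ_{i<k} g(i,k). (This is the coefficient of x^m in ∏_i 1/(1−x_i) · ∏_{i<j} 1/(1−x_i x_j) = Σ_λ s_λ(x).) -/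
namespace CLC

def Il (b a : ℕ → ℕ) : Prop := ∀ i, a (i+1) ≤ b i ∧ b i ≤ a i

def dn (a b u : ℕ → ℕ) : ℕ → ℕ := fun i => max (a (i+1)) (b (i+1)) + min (a i) (b i) - u (i+1)

def up (a b v : ℕ → ℕ) (k : ℕ) : ℕ → ℕ
  | 0 => max (a 0) (b 0) + k
  | i+1 => max (a (i+1)) (b (i+1)) + min (a i) (b i) - v i

lemma dn_il {a b u : ℕ → ℕ} (ha : Il a u) (hb : Il b u) :
    Il (dn a b u) a ∧ Il (dn a b u) b := by
  constructor <;> intro i <;> have h1 := ha i <;> have h2 := hb i <;>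
    have h3 := ha (i+1) <;> have h4 := hb (i+1) <;> simp only [dn] <;> omega

lemma up_il {a b v : ℕ → ℕ} (k : ℕ) (ha : Il v a) (hb : Il v b) :
    Il a (up a b v k) ∧ Il b (up a b v k) := by
  constructor <;> intro i <;> have h1 := ha i <;> have h2 := hb i <;>
    cases i <;> simp only [up] <;> first | omega | skip
  all_goals
    rename_i i
    have h3 := ha i
    have h4 := hb i
    omega

lemma up_dn {a b u : ℕ → ℕ} (ha : Il a u) (hb : Il b u) :
    up a b (dn a b u) (u 0 - max (a 0) (b 0)) = u := by
  funext i
  cases i with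
  | zero => have h1 := ha 0; have h2 := hb 0; simp only [up]; omega
  | succ i => 
    have h1 := ha i; have h2 := hb i; have h3 := ha (i+1); have h4 := hb (i+1)
    simp only [up, dn]; omega

lemma dn_up {a b v : ℕ → ℕ} (k : ℕ) (ha : Il v a) (hb : Il v b) :
    dn a b (up a b v k) = v := by
  funext i
  have h1 := ha i; have h2 := hb i
  simp only [up, dn]; omega

def sz (M : ℕ) (f : ℕ → ℕ) : ℕ := ∑ i ∈ Finset.range M, f i

lemma sz_up {a b v : ℕ → ℕ} (k : ℕ) (ha : Il v a) (hb : Il v b) (M : ℕ)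
    (h1 : a M = 0) (h2 : b M = 0) :
    sz (M+1) (up a b v k) + sz M v = k + sz M a + sz M b := by
  have key : ∀ L, sz (L+1) (up a b v k) + sz L v
      = k + sz L a + sz L b + max (a L) (b L) := by
    intro L
    induction L with
    | zero => simp [sz, up]; omega
    | succ L ih =>
      have h3 := ha L
      have h4 := hb L
      unfold sz at *
      rw [Finset.sum_range_succ _ (L+1)]
      simp only [Finset.sum_range_succ _ L] at *
      have : up a b v k (L+1) = max (a (L+1)) (b (L+1)) + min (a L) (b L) - v L := rfl
      omega
  rw [key, h1, h2]; simp

def GT (n : ℕ) : Set (ℕ → ℕ → ℕ) :=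
  {l | l 0 = 0 ∧ (∀ t < n, Il (l t) (l (t+1))) ∧ ∀ t, n < t → l t = 0}

lemma GT.vanish {n : ℕ} {l : ℕ → ℕ → ℕ} (h : l ∈ GT n) : ∀ t i, t ≤ i → l t i = 0 := by
  intro t
  induction t with
  | zero => intro i _; rw [h.1]; rfl
  | succ t ih =>
    intro i hi
    by_cases ht : t < n
    · obtain ⟨j, rfl⟩ : ∃ j, i = j + 1 := ⟨i - 1, by omega⟩
      have := h.2.1 t ht j
      have := ih j (by omega)
      omega
    · rw [h.2.2 (t+1) (by omega)]; rfl

/-- downward recursion -/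
def nuAux (n : ℕ) (l : ℕ → ℕ → ℕ) : ℕ → ℕ → ℕ
  | 0 => l n
  | d+1 => dn (nuAux n l d) (l (n-d)) (l (n-d+1))

def nu (n : ℕ) (l : ℕ → ℕ → ℕ) (t : ℕ) : ℕ → ℕ := nuAux n l (n+1-t)

lemma nu_top (n l) : nu n l (n+1) = l n := by simp [nu, nuAux]

lemma nu_step (n l t) (h : t ≤ n) : nu n l t = dn (nu n l (t+1)) (l t) (l (t+1)) := by
  obtain ⟨d, rfl⟩ := Nat.exists_eq_add_of_le h
  simp only [nu]
  rw [show t + d + 1 - t = d + 1 by omega, show t + d + 1 - (t+1) = d by omega]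
  simp [nuAux]

lemma nu_il (n l) (hl : l ∈ GT (n+1)) : ∀ d t, t + d = n → Il (nu n l (t+1)) (l (t+1)) := by
  intro d
  induction d with
  | zero => 
    rintro t rfl
    rw [Nat.add_zero, nu_top]; exact hl.2.1 _ (by omega)
  | succ d ih =>
    rintro t ht
    rw [nu_step _ _ _ (by omega)]
    exact (dn_il (ih (t+1) (by omega)) (hl.2.1 _ (by omega))).2

lemma nu_il' (n l) (hl : l ∈ GT (n+1)) (t) (h : t ≤ n) : Il (nu n l (t+1)) (l (t+1)) :=
  nu_il n l hl (n-t) t (by omega)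

lemma nu_il2 (n l) (hl : l ∈ GT (n+1)) (t) (h : t ≤ n) :
    Il (nu n l t) (nu n l (t+1)) ∧ Il (nu n l t) (l t) := by
  rw [nu_step _ _ _ h]
  exact dn_il (nu_il' n l hl t h) (hl.2.1 t (by omega))

def nuT (n : ℕ) (l : ℕ → ℕ → ℕ) (t : ℕ) : ℕ → ℕ := if t ≤ n then nu n l t else 0

lemma nuT_mem (n l) (hl : l ∈ GT (n+1)) : nuT n l ∈ GT n := by
  refine ⟨?_, ?_, ?_⟩
  · funext i
    have := ((nu_il2 n l hl 0 (by omega)).2 i).2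
    rw [hl.1] at this
    simpa [nuT] using this
  · intro t ht
    simp only [nuT, if_pos ht.le, if_pos (Nat.succ_le_of_lt ht)]
    exact (nu_il2 n l hl t ht.le).1
  · intro t ht
    simp [nuT, not_le.2 ht]

def gg (n : ℕ) (l : ℕ → ℕ → ℕ) (t : ℕ) : ℕ :=
  if t ≤ n then l (t+1) 0 - max (nu n l (t+1) 0) (l t 0) else 0

def la (n : ℕ) (v : ℕ → ℕ → ℕ) (g : ℕ → ℕ) : ℕ → ℕ → ℕ
  | 0 => 0
  | t+1 => if t ≤ n then up (if t < n then v (t+1) else la n v g t) (la n v g t) (v t) (g t) else 0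

lemma la_step (n v g t) (h : t < n) :
    la n v g (t+1) = up (v (t+1)) (la n v g t) (v t) (g t) := by
  simp [la, h, h.le]

lemma la_top (n v g) : la n v g (n+1) = up (la n v g n) (la n v g n) (v n) (g n) := by
  simp [la]

lemma la_il (n v g) (hv : v ∈ GT n) : ∀ t ≤ n, Il (v t) (la n v g t) := by
  intro t
  induction t with
  | zero => intro _ i; simp [la, hv.1]
  | succ t ih =>
    intro ht
    rw [la_step _ _ _ _ (by omega)]
    exact (up_il _ (hv.2.1 t (by omega)) (ih (by omega))).1

lemma la_il2 (n v g) (hv : v ∈ GT n) (t) (h : t ≤ n) : Il (la n v g t) (la n v g (t+1)) := by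
  rcases h.lt_or_eq with h | rfl
  · rw [la_step _ _ _ _ h]
    exact (up_il _ (hv.2.1 t h) (la_il n v g hv t h.le)).2
  · rw [la_top]
    exact (up_il _ (la_il _ v g hv _ le_rfl) (la_il _ v g hv _ le_rfl)).2

lemma la_mem (n v g) (hv : v ∈ GT n) : la n v g ∈ GT (n+1) := by
  refine ⟨rfl, fun t ht => la_il2 n v g hv t (by omega), ?_⟩
  intro t ht
  obtain ⟨j, rfl⟩ : ∃ j, t = j + 1 := ⟨t - 1, by omega⟩
  simp [la, show ¬ j ≤ n by omega]

lemma la_nu (n l) (hl : l ∈ GT (n+1)) : la n (nuT n l) (gg n l) = l := by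
  funext t
  induction t with
  | zero => simp [la, hl.1]
  | succ t ih =>
    rcases lt_trichotomy t n with h | rfl | h
    · rw [la_step _ _ _ _ h, ih]
      simp only [nuT, gg, if_pos h.le, if_pos (Nat.succ_le_of_lt h)]
      rw [nu_step n l t h.le]
      exact up_dn (nu_il' n l hl t h.le) (hl.2.1 t (by omega))
    · rw [la_top, ih]
      simp only [nuT, gg, if_pos le_rfl]
      rw [nu_step _ l _ le_rfl, nu_top]
      exact up_dn (hl.2.1 _ (by omega)) (hl.2.1 _ (by omega))
    · rw [hl.2.2 (t+1) (by omega)]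
      simp [la, show ¬ t ≤ n by omega]

lemma nu_la (n v g) (hv : v ∈ GT n) : ∀ d t, t + d = n → nu n (la n v g) t = v t := by
  intro d
  induction d with
  | zero =>
    rintro t rfl
    rw [Nat.add_zero, nu_step _ _ _ le_rfl, nu_top, la_top]
    exact dn_up _ (la_il _ v g hv _ le_rfl) (la_il _ v g hv _ le_rfl)
  | succ d ih =>
    intro t ht
    rw [nu_step _ _ _ (by omega), ih (t+1) (by omega), la_step _ _ _ _ (by omega)]
    exact dn_up _ (hv.2.1 t (by omega)) (la_il n v g hv t (by omega))

lemma nu_la' (n v g) (hv : v ∈ GT n) (t) (h : t ≤ n) : nu n (la n v g) t = v t :=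
  nu_la n v g hv (n-t) t (by omega)

lemma nuT_la (n v g) (hv : v ∈ GT n) : nuT n (la n v g) = v := by
  funext t
  by_cases h : t ≤ n
  · simp only [nuT, if_pos h, nu_la' n v g hv t h]
  · simp only [nuT, if_neg h, hv.2.2 t (by omega)]

lemma gg_la (n v g) (hv : v ∈ GT n) (hg : ∀ t, n < t → g t = 0) : gg n (la n v g) = g := by
  funext t
  by_cases h : t ≤ n
  · simp only [gg, if_pos h]
    rcases h.lt_or_eq with h | rfl
    · rw [nu_la' n v g hv _ (by omega), la_step _ _ _ _ h]
      simp [up]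
    · rw [nu_top, la_top]; simp [up]
  · simp only [gg, if_neg h, hg t (by omega)]

def stepE (n : ℕ) : GT (n+1) ≃ {g : ℕ → ℕ // ∀ t, n < t → g t = 0} × GT n where
  toFun l := (⟨gg n l, fun t ht => by simp [gg, not_le.2 ht]⟩, ⟨nuT n l, nuT_mem n l l.2⟩)
  invFun p := ⟨la n p.2 p.1, la_mem n _ _ p.2.2⟩
  left_inv l := Subtype.ext (la_nu n l l.2)
  right_inv p := Prod.ext (Subtype.ext (gg_la n _ _ p.2.2 p.1.2)) (Subtype.ext (nuT_la n _ _ p.2.2))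

lemma sz_ext {M : ℕ} {f : ℕ → ℕ} (h : f M = 0) : sz (M+1) f = sz M f := by
  simp [sz, Finset.sum_range_succ, h]

lemma la_sz (n v g) (hv : v ∈ GT n) (M : ℕ) (hM : n + 1 ≤ M) (t) (ht : t < n) :
    sz M (la n v g (t+1)) + sz M (v t) = g t + sz M (v (t+1)) + sz M (la n v g t) := by
  have h0 := la_mem n v g hv
  have := sz_up (g t) (hv.2.1 t ht) (la_il n v g hv t ht.le) M (GT.vanish hv _ _ (by omega))
    (GT.vanish h0 _ _ (by omega))
  rw [← la_step _ _ _ _ ht, sz_ext (GT.vanish h0 _ _ (by omega))] at this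
  exact this

lemma la_sz_top (n v g) (hv : v ∈ GT n) (M : ℕ) (hM : n + 1 ≤ M) :
    sz M (la n v g (n+1)) + sz M (v n) = g n + sz M (la n v g n) + sz M (la n v g n) := by
  have h0 := la_mem n v g hv
  have := sz_up (g n) (la_il n v g hv n le_rfl) (la_il n v g hv n le_rfl) M 
    (GT.vanish h0 _ _ (by omega)) (GT.vanish h0 _ _ (by omega))
  rw [← la_top, sz_ext (GT.vanish h0 _ _ (by omega))] at this
  exact this

lemma la_sz_tele (n v g) (hv : v ∈ GT n) (M : ℕ) (hM : n + 1 ≤ M) (t) (ht : t ≤ n) :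
    sz M (la n v g t) = sz M (v t) + ∑ s ∈ Finset.range t, g s := by
  induction t with
  | zero => simp [la, hv.1]
  | succ t ih =>
    have := la_sz n v g hv M hM t ht
    rw [Finset.sum_range_succ]
    have := ih (by omega)
    omega

def D (n : ℕ) : Set (ℕ → ℕ → ℕ) := {a | ∀ i j, ¬ (i ≤ j ∧ j < n) → a i j = 0}

def ct (n : ℕ) (a : ℕ → ℕ → ℕ) (k : ℕ) : ℕ :=
  ∑ j ∈ Finset.range n, a k j + ∑ i ∈ Finset.range k, a i k

def stepD (n : ℕ) : {g : ℕ → ℕ // ∀ t, n < t → g t = 0} × D n ≃ D (n+1) where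
  toFun p := ⟨fun i j => if j = n then p.1.1 i else p.2.1 i j, by
    intro i j h
    dsimp only
    split_ifs with hj
    · exact p.1.2 _ (by omega)
    · exact p.2.2 _ _ (by omega)⟩
  invFun a := (⟨fun i => a.1 i n, fun t ht => a.2 _ _ (by omega)⟩,
    ⟨fun i j => if j = n then 0 else a.1 i j, by
      intro i j h
      dsimp only
      split_ifs with hj
      · rfl
      · exact a.2 _ _ (by omega)⟩)
  left_inv p := by
    refine Prod.ext (Subtype.ext ?_) (Subtype.ext ?_)
    · funext i; simp
    · funext i j
      by_cases h : j = n
      · simp [h, p.2.2 i n (by omega)]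
      · simp [h]
  right_inv a := by
    apply Subtype.ext
    funext i j
    by_cases h : j = n <;> simp [h]

theorem main (n : ℕ) : ∃ e : GT n ≃ D n, ∀ l : GT n, ∀ t < n, ∀ M, n ≤ M →
    sz M (l.1 (t+1)) = sz M (l.1 t) + ct n (e l).1 t := by
  induction n with
  | zero =>
    have h1 : ∀ l : GT 0, l.1 = 0 := fun l => by
      funext t; rcases Nat.eq_zero_or_pos t with rfl | h
      · exact l.2.1
      · exact l.2.2.2 t h
    have h2 : ∀ l : D 0, l.1 = 0 := fun l => by
      funext i j; exact l.2 i j (by omega)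
    refine ⟨⟨fun _ => ⟨0, fun _ _ _ => rfl⟩, fun _ => ⟨0, rfl, fun t ht => by omega, fun _ _ => rfl⟩,
      fun l => Subtype.ext (h1 l).symm, fun l => Subtype.ext (h2 l).symm⟩, fun l t ht => by omega⟩
  | succ n ih =>
    obtain ⟨e, he⟩ := ih
    refine ⟨(stepE n).trans (((Equiv.refl _).prodCongr e).trans (stepD n)), ?_⟩
    intro l
    obtain ⟨⟨⟨g, hg⟩, v⟩, rfl⟩ := (stepE n).symm.surjective l
    intro t ht M hM
    simp only [Equiv.trans_apply, Equiv.apply_symm_apply]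
    change sz M (la n v.1 g (t+1)) = sz M (la n v.1 g t) + ct (n+1) 
      (fun i j => if j = n then g i else (e v).1 i j) t
    rcases (Nat.lt_succ_iff.1 ht).lt_or_eq with h | rfl
    · have h1 := la_sz n v.1 g v.2 M hM t h
      have h2 := he v t h M (by omega)
      have h3 : ct (n+1) (fun i j => if j = n then g i else (e v).1 i j) t 
          = ct n (e v).1 t + g t := by
        simp only [ct, Finset.sum_range_succ, if_true, if_neg h.ne]
        rw [Finset.sum_congr rfl (fun j hj => if_neg (by have := Finset.mem_range.1 hj; omega))]
        exact add_right_comm _ _ _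
      omega
    · have h1 := la_sz_top _ v.1 g v.2 M hM
      have h2 := la_sz_tele _ v.1 g v.2 M hM _ le_rfl
      have h3 : ct (t+1) (fun i j => if j = t then g i else (e v).1 i j) t 
          = g t + ∑ s ∈ Finset.range t, g s := by
        simp only [ct, Finset.sum_range_succ, if_true]
        rw [Finset.sum_congr rfl (fun j hj => if_neg (by have := Finset.mem_range.1 hj; omega))]
        rw [Finset.sum_eq_zero (fun j hj => (e v).2 _ _ (by have := Finset.mem_range.1 hj; omega))]
        omega
      omega

lemma ex_lt (p : ℕ → Prop) (hp : ∀ i j, i ≤ j → p j → p i) (hn : ∃ j, ¬ p j) :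
    ∃ n, ∀ j, j < n ↔ p j := by
  classical
  refine ⟨Nat.find hn, fun j => ⟨fun h => not_not.1 (Nat.find_min hn h), fun h => ?_⟩⟩
  by_contra h2
  exact Nat.find_spec hn (hp _ _ (not_lt.1 h2) h)

abbrev Tab := Σ lam : YoungDiagram, SemistandardYoungTableau lam

lemma lv_ex (P : Tab) (t i : ℕ) : ∃ n, ∀ j, j < n ↔ ((i, j) ∈ P.1 ∧ P.2 i j < t) := by
  apply ex_lt
  · rintro a b hab ⟨h1, h2⟩
    exact ⟨P.1.up_left_mem le_rfl hab h1, (P.2.row_weak_of_le hab h1).trans_lt h2⟩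
  · exact ⟨P.1.rowLen i, fun h => by
      have := YoungDiagram.mem_iff_lt_rowLen.1 h.1
      omega⟩

noncomputable def lv (P : Tab) (t i : ℕ) : ℕ := (lv_ex P t i).choose

lemma lv_iff (P : Tab) (t i j : ℕ) : j < lv P t i ↔ ((i, j) ∈ P.1 ∧ P.2 i j < t) :=
  (lv_ex P t i).choose_spec j

lemma lv_il (P : Tab) (t : ℕ) : Il (lv P t) (lv P (t+1)) := by
  intro i
  constructor
  · apply le_of_forall_lt
    intro j hj
    rw [lv_iff] at hj ⊢
    have := P.2.col_strict (show i < i + 1 by omega) hj.1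
    exact ⟨P.1.up_left_mem (Nat.le_succ i) le_rfl hj.1, by omega⟩
  · apply le_of_forall_lt
    intro j hj
    rw [lv_iff] at hj ⊢
    exact ⟨hj.1, by omega⟩

noncomputable def lvT (N : ℕ) (P : Tab) (t : ℕ) : ℕ → ℕ := if t ≤ N then lv P t else 0

lemma lvT_mem (N P) : lvT N P ∈ GT N := by
  refine ⟨?_, ?_, ?_⟩
  · funext i
    by_contra h
    have h2 : 0 < lv P 0 i := Nat.pos_of_ne_zero (by simpa [lvT] using h)
    rw [lv_iff] at h2
    omega
  · intro t ht
    simp only [lvT, if_pos ht.le, if_pos (Nat.succ_le_of_lt ht)]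
    exact lv_il P t
  · intro t ht
    simp [lvT, not_le.2 ht]

lemma card_lt (N : ℕ) (P : Tab) (t M : ℕ) (ht : t ≤ N) (hM : N ≤ M) :
    (P.1.cells.filter fun c => P.2 c.1 c.2 < t).card = sz M (lvT N P t) := by
  have hv : ∀ i, M ≤ i → lv P t i = 0 := by
    intro i hi
    have := GT.vanish (lvT_mem N P) t i (by omega)
    simpa [lvT, ht] using this
  simp only [lvT, if_pos ht, sz]
  rw [Finset.card_eq_sum_card_fiberwise (f := Prod.fst) (t := Finset.range M)]
  · refine Finset.sum_congr rfl fun i _ => ?_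
    have : Finset.filter (fun c => c.1 = i) (P.1.cells.filter fun c => P.2 c.1 c.2 < t)
        = (Finset.range (lv P t i)).image (fun j => (i, j)) := by
      ext ⟨a, b⟩
      simp only [Finset.mem_filter, Finset.mem_image, Finset.mem_range, lv_iff,
        YoungDiagram.mem_cells, Prod.mk.injEq]
      constructor
      · rintro ⟨h, rfl⟩
        exact ⟨b, h, rfl, rfl⟩
      · rintro ⟨j, h, rfl, rfl⟩
        exact ⟨h, rfl⟩
    rw [this, Finset.card_image_of_injective, Finset.card_range]
    intro x y h
    simpa using h
  · rintro ⟨i, j⟩ h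
    simp only [Finset.coe_filter, Set.mem_setOf_eq, YoungDiagram.mem_cells] at h
    have := (lv_iff P t i j).2 h
    simp only [Finset.coe_range, Set.mem_Iio]
    by_contra h2
    have := hv i (by omega)
    omega

lemma card_eq (N : ℕ) (P : Tab) (t M : ℕ) (ht : t < N) (hM : N ≤ M) :
    sz M (lvT N P (t+1)) = sz M (lvT N P t) +
      (P.1.cells.filter fun c => P.2 c.1 c.2 = t).card := by
  rw [← card_lt N P t M ht.le hM, ← card_lt N P (t+1) M ht hM, ← Finset.card_union_of_disjoint]
  · congr 1
    ext c
    simp only [Finset.mem_filter, Finset.mem_union, ← and_or_left, Nat.lt_succ_iff_lt_or_eq]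
  · rw [Finset.disjoint_left]
    intro c
    simp only [Finset.mem_filter]
    omega

lemma lvT_inj (N : ℕ) (P Q : Tab) (hP : ∀ i j : ℕ, (i, j) ∈ P.1 → P.2 i j < N)
    (hQ : ∀ i j : ℕ, (i, j) ∈ Q.1 → Q.2 i j < N) (h : lvT N P = lvT N Q) : P = Q := by
  have key : ∀ t ≤ N, ∀ i j, ((i, j) ∈ P.1 ∧ P.2 i j < t) ↔ ((i, j) ∈ Q.1 ∧ Q.2 i j < t) := by
    intro t ht i j
    rw [← lv_iff, ← lv_iff]
    have := congrFun (congrFun h t) i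
    simp only [lvT, if_pos ht] at this
    rw [this]
  obtain ⟨p, T⟩ := P
  obtain ⟨q, U⟩ := Q
  dsimp only at *
  have hpq : p = q := by
    ext ⟨i, j⟩
    have := key N le_rfl i j
    simp only [YoungDiagram.mem_cells]
    exact ⟨fun h => (this.1 ⟨h, hP _ _ h⟩).1, fun h => (this.2 ⟨h, hQ _ _ h⟩).1⟩
  subst hpq
  congr 1
  ext i j
  by_cases hm : (i, j) ∈ p
  · have h1 := hP i j hm
    have h2 := hQ i j hm
    have h3 := key (T i j + 1) h1 i j
    have h4 := key (U i j + 1) h2 i j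
    simp only [hm, true_and] at h3 h4
    omega
  · rw [T.zeros hm, U.zeros hm]

lemma GT.mono {N : ℕ} {l : ℕ → ℕ → ℕ} (h : l ∈ GT N) (i : ℕ) :
    ∀ t, t ≤ N → ∀ s, s ≤ t → l s i ≤ l t i := by
  intro t
  induction t with
  | zero => intro _ s hs; rw [Nat.le_zero.1 hs]
  | succ t ih =>
    intro ht s hs
    rcases hs.lt_or_eq with h1 | rfl
    · exact (ih (by omega) s (by omega)).trans (h.2.1 t (by omega) i).2
    · exact le_rfl

lemma GT.anti {N : ℕ} {l : ℕ → ℕ → ℕ} (h : l ∈ GT N) (t : ℕ) (ht : t ≤ N) : Antitone (l t) := by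
  apply antitone_nat_of_succ_le
  intro i
  cases t with
  | zero => simp [h.1]
  | succ t => have := h.2.1 t ht i; omega

lemma ent_ex {N : ℕ} {l : ℕ → ℕ → ℕ} (h : l ∈ GT N) (i j : ℕ) :
    ∃ e, (l N i ≤ j → e = 0) ∧ (j < l N i → ∀ t ≤ N, e < t ↔ j < l t i) := by
  by_cases hj : j < l N i
  · obtain ⟨n, hn⟩ := ex_lt (fun t => t ≤ N ∧ l t i ≤ j) (fun a b hab hb =>
      ⟨hab.trans hb.1, (GT.mono h i b hb.1 a hab).trans hb.2⟩) ⟨N, fun h => by omega⟩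
    refine ⟨n - 1, fun _ => by omega, fun _ t ht => ?_⟩
    have h0 : 0 < n := (hn 0).2 ⟨by omega, by simp [h.1]⟩
    have := hn t
    constructor
    · intro h1
      by_contra h2
      have := this.2 ⟨ht, by omega⟩
      omega
    · intro h1
      by_contra h2
      have := this.1 (by omega)
      omega
  · exact ⟨0, fun _ => rfl, fun h => absurd h hj⟩

lemma lvT_surj (N : ℕ) (l : ℕ → ℕ → ℕ) (h : l ∈ GT N) :
    ∃ P : Tab, (∀ i j : ℕ, (i, j) ∈ P.1 → P.2 i j < N) ∧ lvT N P = l := by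
  choose e he0 he using ent_ex h
  let lam : YoungDiagram :=
    { cells := (Finset.range N ×ˢ Finset.range (l N 0)).filter (fun c => c.2 < l N c.1)
      isLowerSet := by
        rintro ⟨a, b⟩ ⟨c, d⟩ hab hm
        obtain ⟨h1, h2⟩ := Prod.mk_le_mk.1 hab
        simp only [Finset.coe_filter, Finset.mem_product, Finset.mem_range,
          Set.mem_setOf_eq] at hm ⊢
        have := GT.anti h N le_rfl h1
        omega }
  have hmem : ∀ i j, (i, j) ∈ lam ↔ j < l N i := by
    intro i j
    rw [← YoungDiagram.mem_cells]
    simp only [lam, Finset.mem_filter, Finset.mem_product, Finset.mem_range]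
    refine ⟨fun h => h.2, fun h1 => ⟨⟨?_, ?_⟩, h1⟩⟩
    · by_contra h2
      have := GT.vanish h N i (by omega)
      omega
    · have := GT.anti h N le_rfl (Nat.zero_le i)
      omega
  have hcol : ∀ i j, j < l N (i+1) → e i j < e (i+1) j := by
    intro i j hj
    have hj' : j < l N i := by
      have := GT.anti h N le_rfl (Nat.le_succ i)
      simp only [Nat.succ_eq_add_one] at this
      omega
    have h1 : e (i+1) j < N := (he (i+1) j hj N le_rfl).2 hj
    have h2 := (he (i+1) j hj (e (i+1) j + 1) h1).1 (by omega)
    have h3 := h.2.1 _ h1 i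
    exact (he i j hj' _ h1.le).2 (by omega)
  let T : SemistandardYoungTableau lam :=
    { entry := e
      row_weak' := by
        intro i j1 j2 hj hm
        rw [hmem] at hm
        have h1 : e i j2 < N := (he i j2 hm N le_rfl).2 hm
        have h2 := (he i j2 hm (e i j2 + 1) h1).1 (by omega)
        have := (he i j1 (by omega) (e i j2 + 1) h1).2 (by omega)
        omega
      col_strict' := by
        intro i1 i2 j hi hm
        rw [hmem] at hm
        obtain ⟨d, rfl⟩ := Nat.exists_eq_add_of_lt hi
        clear hi
        induction d with
        | zero => exact hcol _ _ hm
        | succ d ih =>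
          have := GT.anti h N le_rfl (show i1 + d + 1 ≤ i1 + (d+1) + 1 by omega)
          exact (ih (by omega)).trans (hcol (i1 + d + 1) j hm)
      zeros' := by
        intro i j hm
        rw [hmem] at hm
        exact he0 i j (by omega) }
  have hT : ∀ i j, T i j = e i j := fun _ _ => rfl
  refine ⟨⟨lam, T⟩, ?_, ?_⟩
  · intro i j hm
    have hm := (hmem i j).1 hm
    exact (he i j hm N le_rfl).2 hm
  · funext t i
    by_cases ht : t ≤ N
    · simp only [lvT, if_pos ht]
      apply eq_of_forall_lt_iff
      intro j
      rw [lv_iff]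
      simp only [hmem, hT]
      constructor
      · rintro ⟨h1, h2⟩
        exact (he i j h1 t ht).1 h2
      · intro h1
        have h2 := h1.trans_le (GT.mono h i N le_rfl t ht)
        exact ⟨h2, (he i j h2 t ht).2 h1⟩
    · simp only [lvT, if_neg ht, h.2.2 t (by omega)]

noncomputable def tabE (N : ℕ) :
    {P : Tab // ∀ i j : ℕ, (i, j) ∈ P.1 → P.2 i j < N} ≃ GT N :=
  Equiv.ofBijective (fun P => ⟨lvT N P.1, lvT_mem N P.1⟩) ⟨by
    intro P Q h
    exact Subtype.ext (lvT_inj N P.1 Q.1 P.2 Q.2 (congrArg Subtype.val h)), by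
    intro l
    obtain ⟨P, hP, h⟩ := lvT_surj N l.1 l.2
    exact ⟨⟨P, hP⟩, Subtype.ext h⟩⟩

def fgE (N : ℕ) : D N ≃ (Fin N → ℕ) × ({p : Fin N × Fin N // p.1 < p.2} → ℕ) where
  toFun a := (fun i => a.1 i i, fun p => a.1 p.1.1 p.1.2)
  invFun q := ⟨fun i j => if h : i ≤ j ∧ j < N then
      (if h2 : i < j then q.2 ⟨(⟨i, by omega⟩, ⟨j, by omega⟩), h2⟩ else q.1 ⟨j, by omega⟩) else 0, by
    intro i j h
    simp [h]⟩
  left_inv a := by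
    apply Subtype.ext
    funext i j
    dsimp only
    split_ifs with h h2
    · rfl
    · have : i = j := by omega
      rw [this]
    · exact (a.2 i j h).symm
  right_inv q := by
    refine Prod.ext ?_ ?_
    · funext i; simp
    · funext p
      have := p.2
      have h1 : p.1.1.1 < p.1.2.1 := p.2
      simp [h1, h1.le]

lemma fgE_ct (N : ℕ) (a : D N) (k : Fin N) :
    ct N a.1 k = (fgE N a).1 k
          + ∑ p ∈ Finset.univ.filter
              (fun p : {p : Fin N × Fin N // p.1 < p.2} => p.1.1 = k), (fgE N a).2 p
          + ∑ p ∈ Finset.univ.filter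
              (fun p : {p : Fin N × Fin N // p.1 < p.2} => p.1.2 = k), (fgE N a).2 p := by
  have h1 : ∑ p ∈ Finset.univ.filter
      (fun p : {p : Fin N × Fin N // p.1 < p.2} => p.1.1 = k), (fgE N a).2 p
      = ∑ j ∈ (Finset.range N).filter (fun j => (k : ℕ) < j), a.1 k j := by
    refine Finset.sum_bij (fun p _ => (p.1.2 : ℕ)) ?_ ?_ ?_ ?_
    · rintro ⟨⟨i, j⟩, hp⟩ h
      simp only [Finset.mem_filter, Finset.mem_univ, true_and] at h
      subst h
      simpa using hp
    · rintro ⟨⟨i, j⟩, hp⟩ h ⟨⟨i', j'⟩, hp'⟩ h' he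
      simp only [Finset.mem_filter, Finset.mem_univ, true_and] at h h'
      subst h h'
      simp only [Subtype.mk.injEq, Prod.mk.injEq, true_and]
      exact Fin.ext he
    · intro j hj
      simp only [Finset.mem_filter, Finset.mem_range] at hj
      exact ⟨⟨(k, ⟨j, hj.1⟩), hj.2⟩, by simp, rfl⟩
    · rintro ⟨⟨i, j⟩, hp⟩ h
      simp only [Finset.mem_filter, Finset.mem_univ, true_and] at h
      subst h
      rfl
  have h2 : ∑ p ∈ Finset.univ.filter
      (fun p : {p : Fin N × Fin N // p.1 < p.2} => p.1.2 = k), (fgE N a).2 p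
      = ∑ i ∈ Finset.range k, a.1 i k := by
    refine Finset.sum_bij (fun p _ => (p.1.1 : ℕ)) ?_ ?_ ?_ ?_
    · rintro ⟨⟨i, j⟩, hp⟩ h
      simp only [Finset.mem_filter, Finset.mem_univ, true_and] at h
      subst h
      simpa using hp
    · rintro ⟨⟨i, j⟩, hp⟩ h ⟨⟨i', j'⟩, hp'⟩ h' he
      simp only [Finset.mem_filter, Finset.mem_univ, true_and] at h h'
      subst h h'
      simp only [Subtype.mk.injEq, Prod.mk.injEq, and_true]
      exact Fin.ext he
    · intro i hi
      simp only [Finset.mem_range] at hi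
      exact ⟨⟨(⟨i, by omega⟩, k), hi⟩, by simp, rfl⟩
    · rintro ⟨⟨i, j⟩, hp⟩ h
      simp only [Finset.mem_filter, Finset.mem_univ, true_and] at h
      subst h
      rfl
  have h3 : ∑ j ∈ Finset.range N, a.1 k j
      = a.1 k k + ∑ j ∈ (Finset.range N).filter (fun j => (k : ℕ) < j), a.1 k j := by
    rw [← Finset.add_sum_erase _ _ (Finset.mem_range.2 k.2)]
    congr 1
    symm
    apply Finset.sum_subset
    · intro j
      simp only [Finset.mem_filter, Finset.mem_erase]
      rintro ⟨h, h'⟩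
      exact ⟨by omega, h⟩
    · intro j hj hj'
      simp only [Finset.mem_filter, Finset.mem_erase] at hj hj'
      refine a.2 _ _ (fun hh => hj' ⟨hj.2, by omega⟩)
  rw [h1, h2, ct, h3]
  rfl

end CLC

/-- **Cauchy–Littlewood identity for the parastatistics algebra, coefficient form.**
For every `N > 0` and content function `m : Fin N → ℕ`, the number of semistandard
Young tableaux (of arbitrary shape) with entries in `{0, …, N-1}` and exactly `m i`
entries equal to `i`, equals the number of pairs `(f, g)` with `f : Fin N → ℕ` and
`g` defined on pairs `i < j`, such that `m k = f k + Σ_{j > k} g (k,j) + Σ_{i < k} g (i,k)`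
for every `k`.  (This is the coefficient of `x^m` in
`∏ᵢ 1/(1-xᵢ) ∏_{i<j} 1/(1-xᵢxⱼ) = Σ_λ s_λ(x)`.) -/
theorem cauchy_littlewood_coefficient (N : ℕ) (hN : 0 < N) (m : Fin N → ℕ) :
    Nat.card {P : Σ lam : YoungDiagram, SemistandardYoungTableau lam //
        (∀ i j : ℕ, (i, j) ∈ P.1 → P.2 i j < N) ∧
        ∀ k : Fin N, (P.1.cells.filter fun c => P.2 c.1 c.2 = (k : ℕ)).card = m k} =
    Nat.card {fg : (Fin N → ℕ) × ({p : Fin N × Fin N // p.1 < p.2} → ℕ) //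
        ∀ k : Fin N, m k = fg.1 k
          + ∑ p ∈ Finset.univ.filter
              (fun p : {p : Fin N × Fin N // p.1 < p.2} => p.1.1 = k), fg.2 p
          + ∑ p ∈ Finset.univ.filter
              (fun p : {p : Fin N × Fin N // p.1 < p.2} => p.1.2 = k), fg.2 p} := by
  obtain ⟨e, he⟩ := CLC.main N
  refine Nat.card_congr ((Equiv.subtypeSubtypeEquivSubtypeInter
    (fun P : CLC.Tab => ∀ i j : ℕ, (i, j) ∈ P.1 → P.2 i j < N)
    (fun P : CLC.Tab => ∀ k : Fin N,
      (P.1.cells.filter fun c => P.2 c.1 c.2 = (k : ℕ)).card = m k)).symm.trans ?_)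
  refine ((CLC.tabE N).trans (e.trans (CLC.fgE N))).subtypeEquiv ?_
  intro P
  refine forall_congr' fun k => ?_
  simp only [Equiv.trans_apply]
  rw [← CLC.fgE_ct]
  have h1 := he (CLC.tabE N P) k k.2 N le_rfl
  have h2 : CLC.sz N ((CLC.tabE N P).1 (k+1)) = CLC.sz N ((CLC.tabE N P).1 k) + _ :=
    CLC.card_eq N P.1 k N k.2 le_rfl
  rw [h2] at h1
  rw [← Nat.add_left_cancel h1]
  exact eq_comm
end
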